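/- arXiv:2602.19256 — 3 statements merged into one kernel-verified Lean document; each statement's English description precedes it below -/
import Mathlib

section
/- Let f : [0,1] → [0,1] be a continuous piecewise monotone map and for each n ≥ 1 let c_n be the number of maximal intervals of monotonicity of the n-th iterate f^n. Then the polynomial entropy of f satisfies h_pol(f) ≤ 1 + limsup_{n→∞} log c_n / log n. -/
open Filter Topology TopologicalSpace Set
open scoped ENNReal NNReal

variable {X : Type*}

/-- The dynamical (Bowen) distance `d_n^f(x,y) = max_{0 ≤ k ≤ n-1} d(f^k x, f^k y)`. -/
noncomputable def dynDist [PseudoMetricSpace X] (f : X → X) (n : ℕ) (x y : X) : ℝ :=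
  (((Finset.range n).sup fun k => nndist (f^[k] x) (f^[k] y) : ℝ≥0) : ℝ)

/-- `E` is `(n, ε)`-separated for `f`: distinct points of `E` are at `d_n^f`-distance `≥ ε`. -/
def IsDynSeparated [PseudoMetricSpace X] (f : X → X) (n : ℕ) (ε : ℝ) (E : Set X) : Prop :=
  ∀ x ∈ E, ∀ y ∈ E, x ≠ y → ε ≤ dynDist f n x y

/-- `sep(n, ε)`: the maximal cardinality of a finite `(n, ε)`-separated set. -/
noncomputable def sepCount [PseudoMetricSpace X] (f : X → X) (n : ℕ) (ε : ℝ) : ℕ∞ :=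
  ⨆ (E : Finset X) (_ : IsDynSeparated f n ε (E : Set X)), (E.card : ℕ∞)

/-- `limsup_{n → ∞} log (u n) / log n`, valued in `[0, ∞]`. -/
noncomputable def polGrowth (u : ℕ → ℕ∞) : ℝ≥0∞ :=
  Filter.atTop.limsup fun n =>
    if u n = ⊤ then ⊤ else ENNReal.ofReal (Real.log ((u n).toNat : ℝ) / Real.log n)

/-- Polynomial entropy: `lim_{ε → 0⁺} limsup_{n → ∞} log sep(n,ε) / log n`; since the inner
quantity is antitone in `ε`, the limit as `ε → 0⁺` equals the supremum over `ε > 0`. -/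
noncomputable def hpol [PseudoMetricSpace X] (f : X → X) : ℝ≥0∞ :=
  ⨆ (ε : ℝ) (_ : 0 < ε), polGrowth fun n => sepCount f n ε

/-- `J` is a maximal interval of monotonicity of `g`: a nonempty order-connected set on which
`g` is monotone (increasing or decreasing), maximal with these properties. -/
def IsMaximalMonotonicityInterval {Y : Type*} [LinearOrder Y] (g : Y → Y) (J : Set Y) : Prop :=
  J.Nonempty ∧ J.OrdConnected ∧ (MonotoneOn g J ∨ AntitoneOn g J) ∧
    ∀ J' : Set Y, J ⊆ J' → J'.OrdConnected → (MonotoneOn g J' ∨ AntitoneOn g J') → J' = J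

section Closure

variable {α β : Type*} [LinearOrder α] [TopologicalSpace α] [OrderTopology α]

theorem Set.OrdConnected.closure_of_linearOrder {J : Set α} (hJ : J.OrdConnected) :
    (closure J).OrdConnected := by
  refine ⟨fun x hx y hy z hz => ?_⟩
  rcases hz.1.eq_or_lt with rfl | hxz
  · exact hx
  rcases hz.2.eq_or_lt with rfl | hzy
  · exact hy
  obtain ⟨u, huz, huJ⟩ := mem_closure_iff.1 hx (Iio z) isOpen_Iio hxz
  obtain ⟨v, hzv, hvJ⟩ := mem_closure_iff.1 hy (Ioi z) isOpen_Ioi hzy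
  exact subset_closure (hJ.out huJ hvJ ⟨le_of_lt huz, le_of_lt hzv⟩)

theorem MonotoneOn.closure_of_continuous [Preorder β] [TopologicalSpace β]
    [OrderClosedTopology β] {g : α → β} (hg : Continuous g) {J : Set α} (h : MonotoneOn g J) :
    MonotoneOn g (closure J) := by
  intro x hx y hy hxy
  rcases hxy.eq_or_lt with rfl | hlt
  · exact le_rfl
  have hmem : (x, y) ∈ closure (J ×ˢ J) := by
    rw [closure_prod_eq]
    exact ⟨hx, hy⟩
  have : (𝓝[J ×ˢ J] (x, y)).NeBot := mem_closure_iff_nhdsWithin_neBot.1 hmem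
  refine le_of_tendsto_of_tendsto (b := 𝓝[J ×ˢ J] (x, y))
    (((hg.comp continuous_fst).tendsto (x, y)).mono_left nhdsWithin_le_nhds)
    (((hg.comp continuous_snd).tendsto (x, y)).mono_left nhdsWithin_le_nhds) ?_
  have hord : ∀ᶠ p : α × α in 𝓝[J ×ˢ J] (x, y), p.1 < p.2 :=
    nhdsWithin_le_nhds ((isOpen_lt continuous_fst continuous_snd).mem_nhds hlt)
  filter_upwards [hord, self_mem_nhdsWithin] with p hp hpJ
  exact h hpJ.1 hpJ.2 hp.le

theorem AntitoneOn.closure_of_continuous [Preorder β] [TopologicalSpace β]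
    [OrderClosedTopology β] {g : α → β} (hg : Continuous g) {J : Set α} (h : AntitoneOn g J) :
    AntitoneOn g (closure J) :=
  MonotoneOn.closure_of_continuous (β := βᵒᵈ) hg h

end Closure

theorem eVariationOn_neg_eq {α : Type*} [LinearOrder α] (g : α → ℝ) (s : Set α) :
    eVariationOn (fun x => -g x) s = eVariationOn g s := by
  simp [eVariationOn, edist_neg_neg]

theorem eVariationOn_Icc_le_one {α : Type*} [LinearOrder α] {g : α → ℝ}
    (h01 : ∀ x, g x ∈ Icc (0 : ℝ) 1) {a b : α} (hab : a ≤ b)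
    (h : MonotoneOn g (Icc a b) ∨ AntitoneOn g (Icc a b)) :
    eVariationOn g (Icc a b) ≤ 1 := by
  have ha : a ∈ Icc a b := ⟨le_rfl, hab⟩
  have hb : b ∈ Icc a b := ⟨hab, le_rfl⟩
  rcases h with h | h
  · have := h.eVariationOn_eq ha hb
    rw [inter_self] at this
    rw [this, ENNReal.ofReal_le_one]
    linarith [(h01 a).1, (h01 b).2]
  · have := h.neg.eVariationOn_eq ha hb
    rw [inter_self] at this
    rw [← eVariationOn_neg_eq]
    rw [this, ENNReal.ofReal_le_one]
    linarith [(h01 a).2, (h01 b).1]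

/-- A `[0,1]`-valued function that is monotone on each of finitely many closed order-connected sets
covering an interval has variation at most the number of these sets. -/
theorem eVariationOn_Icc_le_card_of_cover {α : Type*} [LinearOrder α] [TopologicalSpace α]
    [OrderTopology α] [DenselyOrdered α] [CompactIccSpace α] {g : α → ℝ}
    (h01 : ∀ x, g x ∈ Icc (0 : ℝ) 1) (m : ℕ) (S : Finset (Set α)) (hm : S.card = m)
    (hS : ∀ J ∈ S, IsClosed J ∧ J.OrdConnected ∧ (MonotoneOn g J ∨ AntitoneOn g J))
    {a b : α} (hab : a ≤ b) (hcov : Icc a b ⊆ ⋃ J ∈ S, J) :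
    eVariationOn g (Icc a b) ≤ m := by
  classical
  induction m generalizing S b with
  | zero =>
    obtain rfl := Finset.card_eq_zero.1 hm
    simpa using hcov (right_mem_Icc.2 hab)
  | succ m ih =>
    obtain ⟨J, hJS, hbJ⟩ := mem_iUnion₂.1 (hcov (right_mem_Icc.2 hab))
    obtain ⟨hJcl, hJoc, hJmon⟩ := hS J hJS
    obtain ⟨c, ⟨⟨hac, hcb⟩, hcJ⟩, hcmin⟩ :=
      ((isCompact_Icc (a := a) (b := b)).inter_right hJcl).exists_isLeast
        ⟨b, right_mem_Icc.2 hab, hbJ⟩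
    have hsub : Icc c b ⊆ J := hJoc.out hcJ hbJ
    have hlast : eVariationOn g (Icc c b) ≤ 1 :=
      eVariationOn_Icc_le_one h01 hcb (hJmon.imp (·.mono hsub) (·.mono hsub))
    rcases hac.eq_or_lt with rfl | hlt
    · exact hlast.trans (by simp)
    have hfirst : eVariationOn g (Icc a c) ≤ m := by
      refine ih (S.erase J) (by rw [Finset.card_erase_of_mem hJS, hm]; rfl)
        (fun K hK => hS K (Finset.mem_of_mem_erase hK)) hac ?_
      rw [← closure_Ico hlt.ne]
      refine closure_minimal (fun x hx => ?_)
        ((S.erase J).finite_toSet.isClosed_biUnion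
          fun K hK => (hS K (Finset.mem_of_mem_erase hK)).1)
      have hxb : x ∈ Icc a b := ⟨hx.1, hx.2.le.trans hcb⟩
      obtain ⟨K, hKS, hxK⟩ := mem_iUnion₂.1 (hcov hxb)
      refine mem_iUnion₂.2 ⟨K, Finset.mem_erase.2 ⟨?_, hKS⟩, hxK⟩
      rintro rfl
      exact (hcmin ⟨hxb, hxK⟩).not_gt hx.2
    have hsplit := eVariationOn.Icc_add_Icc g (s := univ) hac hcb (mem_univ c)
    simp only [univ_inter] at hsplit
    rw [← hsplit]
    push_cast
    exact add_le_add hfirst hlast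

theorem exists_isMaximalMonotonicityInterval_mem {Y : Type*} [LinearOrder Y] (g : Y → Y) (x : Y) :
    ∃ J, IsMaximalMonotonicityInterval g J ∧ x ∈ J := by
  have hub : ∀ C ⊆ {J : Set Y | J.OrdConnected ∧ (MonotoneOn g J ∨ AntitoneOn g J)},
      IsChain (· ⊆ ·) C → C.Nonempty →
      ∃ ub ∈ {J : Set Y | J.OrdConnected ∧ (MonotoneOn g J ∨ AntitoneOn g J)},
        ∀ s ∈ C, s ⊆ ub := by
    intro C hC hchain _
    have hdir : DirectedOn (· ⊆ ·) C := hchain.directedOn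
    refine ⟨⋃₀ C, ⟨⟨fun u hu v hv z hz => ?_⟩, ?_⟩, fun s hs => subset_sUnion_of_mem hs⟩
    · obtain ⟨U, hU, huU⟩ := hu
      obtain ⟨V, hV, hvV⟩ := hv
      obtain ⟨W, hW, hUW, hVW⟩ := hdir U hU V hV
      exact ⟨W, hW, (hC hW).1.out (hUW huU) (hVW hvV) hz⟩
    · by_cases hall : ∀ K ∈ C, MonotoneOn g K
      · left
        rintro u ⟨U, hU, huU⟩ v ⟨V, hV, hvV⟩ huv
        obtain ⟨W, hW, hUW, hVW⟩ := hdir U hU V hV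
        exact hall W hW (hUW huU) (hVW hvV) huv
      · right
        push Not at hall
        obtain ⟨K, hK, hKmon⟩ := hall
        rintro u ⟨U, hU, huU⟩ v ⟨V, hV, hvV⟩ huv
        obtain ⟨W, hW, hUW, hVW⟩ := hdir U hU V hV
        obtain ⟨W', hW', hWW', hKW'⟩ := hdir W hW K hK
        exact ((hC hW').2.resolve_left fun h => hKmon (h.mono hKW'))
          (hWW' (hUW huU)) (hWW' (hVW hvV)) huv
  obtain ⟨J, hxJ, hJ⟩ := zorn_subset_nonempty _ hub {x}
    ⟨ordConnected_singleton, Or.inl (subsingleton_singleton.monotoneOn g)⟩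
  refine ⟨J, ⟨⟨x, hxJ rfl⟩, hJ.1.1, hJ.1.2, fun J' hJJ' hoc hmon => ?_⟩, hxJ rfl⟩
  exact (hJ.2 ⟨hoc, hmon⟩ hJJ').antisymm hJJ'

theorem eVariationOn_le_encard_maximalMonotonicityIntervals
    {g : Icc (0 : ℝ) 1 → Icc (0 : ℝ) 1} (hg : Continuous g) {m : ℕ}
    (hm : {J : Set (Icc (0 : ℝ) 1) | IsMaximalMonotonicityInterval g J}.encard = (m : ℕ∞)) :
    eVariationOn (fun x => (g x : ℝ)) univ ≤ m := by
  classical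
  have hfin : {J : Set (Icc (0 : ℝ) 1) | IsMaximalMonotonicityInterval g J}.Finite :=
    finite_of_encard_eq_coe hm
  have hcard : hfin.toFinset.card = m := by
    rw [hfin.encard_eq_coe_toFinset_card] at hm
    exact_mod_cast hm
  have huniv : (univ : Set (Icc (0 : ℝ) 1)) = Icc ⊥ ⊤ := by simp
  rw [huniv]
  refine (eVariationOn_Icc_le_card_of_cover (fun x => (g x).2) _
    (hfin.toFinset.image closure) rfl ?_ bot_le ?_).trans ?_
  · intro K hK
    obtain ⟨J, hJ, rfl⟩ := Finset.mem_image.1 hK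
    have hJ' : IsMaximalMonotonicityInterval g J := hfin.mem_toFinset.1 hJ
    refine ⟨isClosed_closure, hJ'.2.1.closure_of_linearOrder, ?_⟩
    exact hJ'.2.2.1.imp (fun h => h.closure_of_continuous hg) fun h => h.closure_of_continuous hg
  · intro x _
    obtain ⟨J, hJ, hxJ⟩ := exists_isMaximalMonotonicityInterval_mem g x
    exact mem_iUnion₂.2 ⟨closure J, Finset.mem_image_of_mem _ (hfin.mem_toFinset.2 hJ),
      subset_closure hxJ⟩
  · exact_mod_cast Finset.card_image_le.trans hcard.le

theorem ofReal_dynDist_le_sum_edist {Y : Type*} [PseudoMetricSpace Y] (f : Y → Y) (n : ℕ) (x y : Y) :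
    ENNReal.ofReal (dynDist f n x y) ≤ ∑ k ∈ Finset.range n, edist (f^[k] x) (f^[k] y) := by
  simp only [dynDist, ENNReal.ofReal_coe_nnreal, edist_nndist]
  rw [← ENNReal.ofNNReal_finsetSum]
  refine ENNReal.coe_le_coe.2 (Finset.sup_le fun k hk => ?_)
  exact Finset.single_le_sum (f := fun k => nndist (f^[k] x) (f^[k] y)) (fun _ _ => zero_le) hk

/-- Consecutive points of a separated set are separated at some time, so the set is no larger than
the total variation of the first iterates allows. -/
theorem IsDynSeparated.card_mul_le {Y : Type*} [LinearOrder Y] [PseudoMetricSpace Y] {f : Y → Y}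
    {n : ℕ} {ε : ℝ} {E : Finset Y} (hE : IsDynSeparated f n ε (E : Set Y)) :
    ((E.card - 1 : ℕ) : ℝ≥0∞) * ENNReal.ofReal ε ≤
      ∑ k ∈ Finset.range n, eVariationOn (f^[k]) univ := by
  rcases Nat.eq_zero_or_pos E.card with h0 | hpos
  · simp [h0]
  obtain ⟨m, hm⟩ : ∃ m, E.card = m + 1 := ⟨E.card - 1, by omega⟩
  let e := E.orderEmbOfFin hm
  let u : ℕ → Y := fun i => e ⟨min i m, by omega⟩
  have hu : Monotone u := fun i j hij => e.monotone (by simp; omega)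
  have hsep : ∀ i ∈ Finset.range m, ε ≤ dynDist f n (u (i + 1)) (u i) := by
    intro i hi
    have him := Finset.mem_range.1 hi
    refine hE _ (E.orderEmbOfFin_mem hm _) _ (E.orderEmbOfFin_mem hm _) fun h => ?_
    have := Fin.mk.inj_iff.1 (e.injective h)
    omega
  calc ((E.card - 1 : ℕ) : ℝ≥0∞) * ENNReal.ofReal ε
      = ∑ i ∈ Finset.range m, ENNReal.ofReal ε := by simp [hm]
    _ ≤ ∑ i ∈ Finset.range m, ∑ k ∈ Finset.range n, edist (f^[k] (u (i + 1))) (f^[k] (u i)) :=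
        Finset.sum_le_sum fun i hi =>
          (ENNReal.ofReal_le_ofReal (hsep i hi)).trans (ofReal_dynDist_le_sum_edist f n _ _)
    _ = ∑ k ∈ Finset.range n, ∑ i ∈ Finset.range m, edist (f^[k] (u (i + 1))) (f^[k] (u i)) :=
        Finset.sum_comm
    _ ≤ ∑ k ∈ Finset.range n, eVariationOn (f^[k]) univ :=
        Finset.sum_le_sum fun k _ => eVariationOn.sum_le hu fun _ => mem_univ _

theorem sepCount_le_of_card_le {Y : Type*} [PseudoMetricSpace Y] {f : Y → Y} {n : ℕ} {ε B : ℝ}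
    (h : ∀ E : Finset Y, IsDynSeparated f n ε (E : Set Y) → (E.card : ℝ) ≤ B) :
    sepCount f n ε ≠ ⊤ ∧ ((sepCount f n ε).toNat : ℝ) ≤ B := by
  have hB : 0 ≤ B := by simpa using h ∅ (by simp [IsDynSeparated])
  have hle : sepCount f n ε ≤ (⌊B⌋₊ : ℕ) :=
    iSup₂_le fun E hE => by exact_mod_cast Nat.le_floor (h E hE)
  refine ⟨ne_top_of_le_ne_top (ENat.natCast_ne_top _) hle, ?_⟩
  exact (Nat.cast_le.2 (ENat.toNat_le_of_le_natCast hle)).trans (Nat.floor_le hB)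

theorem polGrowth_le_one_add_of_le_sum {u : ℕ → ℕ∞} (c : ℕ → ℕ) {ε : ℝ} (hε : 0 < ε)
    (hu : ∀ n, u n ≠ ⊤ ∧ ((u n).toNat : ℝ) ≤ 1 + (∑ k ∈ Finset.range n, (c k : ℝ)) / ε) :
    polGrowth u ≤ 1 + polGrowth (fun n => (c n : ℕ∞)) := by
  refine ENNReal.le_of_forall_pos_le_add fun δ hδ hfin => ?_
  have hL : polGrowth (fun n => (c n : ℕ∞)) ≠ ⊤ := (ENNReal.add_lt_top.1 hfin).2.ne
  set L := polGrowth (fun n => (c n : ℕ∞)) with hLdef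
  have hδ' : (0 : ℝ) < δ := hδ
  set β : ℝ := L.toReal + δ / 2 with hβ
  have hβ0 : 0 < β := by positivity
  have hLβ : L < ENNReal.ofReal β := by
    rw [← ENNReal.ofReal_toReal hL]
    exact (ENNReal.ofReal_lt_ofReal_iff hβ0).2 (by linarith)
  have hc : ∀ᶠ n : ℕ in atTop, (c n : ℝ) ≤ (n : ℝ) ^ β := by
    filter_upwards [eventually_lt_of_limsup_lt hLβ, eventually_ge_atTop 2] with n hn hn2
    rw [if_neg (ENat.natCast_ne_top _), ENat.toNat_natCast, ENNReal.ofReal_lt_ofReal_iff hβ0] at hn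
    have hn1 : (1 : ℝ) < n := by exact_mod_cast hn2
    rw [div_lt_iff₀ (Real.log_pos hn1)] at hn
    rcases Nat.eq_zero_or_pos (c n) with h0 | hpos
    · rw [h0, Nat.cast_zero]
      positivity
    · exact Real.le_rpow_of_log_le (by linarith) hn.le
  obtain ⟨N, hN⟩ := eventually_atTop.1 hc
  set A : ℝ := ∑ k ∈ Finset.range N, (c k : ℝ) with hA
  have hA0 : 0 ≤ A := Finset.sum_nonneg fun _ _ => Nat.cast_nonneg _
  have hsum : ∀ n, N ≤ n → ∑ k ∈ Finset.range n, (c k : ℝ) ≤ A + n * (n : ℝ) ^ β := by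
    intro n hn
    induction n, hn using Nat.le_induction with
    | base =>
      have : (0 : ℝ) ≤ N * (N : ℝ) ^ β := by positivity
      linarith
    | succ n hn ih =>
      rw [Finset.sum_range_succ]
      have hpow : (n : ℝ) ^ β ≤ ((n + 1 : ℕ) : ℝ) ^ β :=
        Real.rpow_le_rpow (Nat.cast_nonneg _) (by push_cast; linarith) hβ0.le
      have hmul := mul_le_mul_of_nonneg_left hpow (Nat.cast_nonneg (α := ℝ) (n + 1))
      have := hN n hn
      push_cast at hmul ⊢
      linarith
  set B : ℝ := 1 + (A + 1) / ε with hB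
  have hB1 : 1 ≤ B := by
    have : 0 ≤ (A + 1) / ε := by positivity
    linarith
  have hlim : Tendsto (fun n : ℕ => Real.log B / Real.log n) atTop (𝓝 0) :=
    (Real.tendsto_log_atTop.comp tendsto_natCast_atTop_atTop).const_div_atTop _
  have hsmall : ∀ᶠ n : ℕ in atTop, Real.log B / Real.log n < δ / 2 :=
    hlim.eventually_lt_const (by positivity)
  have hgoal : 1 + L + δ = ENNReal.ofReal (1 + β + δ / 2) := by
    rw [show 1 + β + (δ : ℝ) / 2 = 1 + L.toReal + δ by rw [hβ]; ring,
      ENNReal.ofReal_add (by positivity) hδ'.le, ENNReal.ofReal_add zero_le_one (by positivity),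
      ENNReal.ofReal_toReal hL, ENNReal.ofReal_one, ENNReal.ofReal_coe_nnreal]
  rw [hgoal]
  refine limsup_le_of_le (by isBoundedDefault) ?_
  filter_upwards [hsmall, eventually_ge_atTop N, eventually_ge_atTop 2] with n hsn hNn hn2
  rw [if_neg (hu n).1]
  refine ENNReal.ofReal_le_ofReal ?_
  have hn1 : (1 : ℝ) < n := by exact_mod_cast hn2
  have hlog : 0 < Real.log n := Real.log_pos hn1
  set P : ℝ := n * (n : ℝ) ^ β with hP
  have hP1 : 1 ≤ P := by
    nlinarith [Real.one_le_rpow hn1.le hβ0.le]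
  have hub : ((u n).toNat : ℝ) ≤ B * P := by
    refine (hu n).2.trans ?_
    have h1 : (∑ k ∈ Finset.range n, (c k : ℝ)) / ε ≤ (A + 1) * P / ε := by
      gcongr
      nlinarith [hsum n hNn]
    rw [hB, add_mul, one_mul, div_mul_eq_mul_div]
    linarith
  have hlogP : Real.log (B * P) = Real.log B + (1 + β) * Real.log n := by
    rw [Real.log_mul (by positivity) (by positivity), hP,
      Real.log_mul (by positivity) (by positivity), Real.log_rpow (by positivity)]
    ring
  have hlogu : Real.log ((u n).toNat : ℝ) ≤ Real.log B + (1 + β) * Real.log n := by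
    rw [← hlogP]
    rcases Nat.eq_zero_or_pos (u n).toNat with h0 | hpos
    · rw [h0, Nat.cast_zero, Real.log_zero]
      exact Real.log_nonneg (one_le_mul_of_one_le_of_one_le hB1 hP1)
    · exact Real.log_le_log (by exact_mod_cast hpos) hub
  rw [div_lt_iff₀ hlog] at hsn
  rw [div_le_iff₀ hlog]
  linarith

/-- for a continuous piecewise monotone map `f` of `[0,1]`, if `c n` is the number
of maximal intervals of monotonicity of `f^n`, then
`h_pol(f) ≤ 1 + limsup_{n→∞} log c_n / log n`. -/
theorem hpol_le_one_add_lapNumber_growth_of_piecewise_monotone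
    (f : Set.Icc (0:ℝ) 1 → Set.Icc (0:ℝ) 1) (hf : Continuous f)
    (hpm : ∃ (k : ℕ) (a : Fin (k + 1) → Set.Icc (0:ℝ) 1),
      StrictMono a ∧ a 0 = ⟨0, by norm_num⟩ ∧ a (Fin.last k) = ⟨1, by norm_num⟩ ∧
      ∀ i : Fin k, MonotoneOn f (Set.Icc (a i.castSucc) (a i.succ)) ∨
        AntitoneOn f (Set.Icc (a i.castSucc) (a i.succ)))
    (c : ℕ → ℕ)
    (hc : ∀ n : ℕ, 1 ≤ n →
      {J : Set (Set.Icc (0:ℝ) 1) | IsMaximalMonotonicityInterval (f^[n]) J}.encard = (c n : ℕ∞)) :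
    hpol f ≤ 1 + polGrowth (fun n => (c n : ℕ∞)) := by
  have hc0 : polGrowth (fun n => (Function.update c 0 1 n : ℕ∞)) =
      polGrowth (fun n => (c n : ℕ∞)) := by
    refine limsup_congr ?_
    filter_upwards [eventually_ge_atTop 1] with n hn
    simp only [Function.update_of_ne (show n ≠ 0 by omega)]
  have hvar : ∀ k, eVariationOn (f^[k]) univ ≤ ((Function.update c 0 1 k : ℕ) : ℝ≥0∞) := by
    intro k
    change eVariationOn (fun x => (f^[k] x : ℝ)) univ ≤ _
    rcases Nat.eq_zero_or_pos k with rfl | hk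
    · rw [show (univ : Set (Icc (0 : ℝ) 1)) = Icc ⊥ ⊤ by simp]
      simpa using eVariationOn_Icc_le_one (g := fun x : Icc (0 : ℝ) 1 => (x : ℝ))
        (fun x => x.2) (bot_le (a := ⊤)) (Or.inl fun _ _ _ _ h => h)
    · rw [Function.update_of_ne hk.ne']
      exact eVariationOn_le_encard_maximalMonotonicityIntervals (hf.iterate k) (hc k hk)
  refine iSup₂_le fun ε hε => ?_
  rw [← hc0]
  refine polGrowth_le_one_add_of_le_sum (Function.update c 0 1) hε fun n =>
    sepCount_le_of_card_le fun E hE => ?_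
  have h := hE.card_mul_le.trans (Finset.sum_le_sum fun k _ => hvar k)
  have h' : ((E.card - 1 : ℕ) : ℝ) * ε ≤ ∑ k ∈ Finset.range n, (Function.update c 0 1 k : ℝ) := by
    have := ENNReal.toReal_mono (by simp [← Nat.cast_sum]) h
    rwa [ENNReal.toReal_mul, ENNReal.toReal_natCast, ENNReal.toReal_ofReal hε.le, ← Nat.cast_sum,
      ENNReal.toReal_natCast, Nat.cast_sum] at this
  have h1 : (E.card : ℝ) ≤ 1 + ((E.card - 1 : ℕ) : ℝ) := by
    exact_mod_cast (by omega : E.card ≤ 1 + (E.card - 1))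
  have h2 := (le_div_iff₀ hε).2 h'
  linarith
end

section
/- Let X be a compact metric space and f : X → X a homeomorphism possessing a wandering point. Then for every n ≥ 1 the induced map F_n(f) on the n-fold symmetric product satisfies h_pol(F_n(f)) ≥ n. -/
open Filter Topology TopologicalSpace Set
open scoped ENNReal NNReal

variable {X : Type*}

/-- A wandering point: some open neighbourhood `U` of `p` satisfies `f^n(U) ∩ U = ∅` for all
`n ≥ 1`. -/
def IsWanderingPoint [TopologicalSpace X] (f : X → X) (p : X) : Prop :=
  ∃ U : Set X, IsOpen U ∧ p ∈ U ∧ ∀ n : ℕ, 1 ≤ n → f^[n] '' U ∩ U = ∅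

/-- The induced map `2^f : A ↦ f(A)` on the hyperspace of nonempty closed subsets of a compact
metric space (equivalently, nonempty compact subsets), with the Hausdorff metric. -/
noncomputable def hyperMap [TopologicalSpace X] (f : X → X) (hf : Continuous f) :
    NonemptyCompacts X → NonemptyCompacts X :=
  fun A => ⟨⟨f '' (A : Set X), A.isCompact.image hf⟩, A.nonempty.image f⟩

/-- The `n`-fold symmetric product `F_n(X)`: nonempty subsets of `X` of cardinality at most `n`,
as a metric subspace of the hyperspace `2^X` with the Hausdorff metric. -/
abbrev SymmProd (X : Type*) [MetricSpace X] (n : ℕ) : Type _ :=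
  {A : NonemptyCompacts X // (A : Set X).encard ≤ n}

/-- The induced map `F_n(f) : F_n(X) → F_n(X)`, `A ↦ f(A)`. -/
noncomputable def symmMap [MetricSpace X] (f : X → X) (hf : Continuous f) (n : ℕ) :
    SymmProd X n → SymmProd X n :=
  fun A => ⟨hyperMap f hf A.1, le_trans (Set.encard_image_le f (A.1 : Set X)) A.2⟩

theorem dist_iterate_le_dynDist {Y : Type*} [PseudoMetricSpace Y] (f : Y → Y) {k N : ℕ}
    (hk : k < N) (x y : Y) : dist (f^[k] x) (f^[k] y) ≤ dynDist f N x y := by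
  rw [dynDist, ← coe_nndist, NNReal.coe_le_coe]
  exact Finset.le_sup (f := fun k => nndist (f^[k] x) (f^[k] y)) (Finset.mem_range.2 hk)

theorem dynDist_self {Y : Type*} [PseudoMetricSpace Y] (f : Y → Y) (N : ℕ) (x : Y) :
    dynDist f N x x = 0 := by
  simp [dynDist]

theorem card_le_sepCount {ι Y : Type*} [Fintype ι] [PseudoMetricSpace Y] (f : Y → Y) (N : ℕ)
    {ε : ℝ} (hε : 0 < ε) (g : ι → Y) (hg : ∀ i j, i ≠ j → ε ≤ dynDist f N (g i) (g j)) :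
    (Fintype.card ι : ℕ∞) ≤ sepCount f N ε := by
  have hinj : Function.Injective g := by
    intro i j hij
    by_contra hne
    have := hg i j hne
    rw [hij, dynDist_self] at this
    linarith
  have hsep : IsDynSeparated f N ε ((Finset.univ.map ⟨g, hinj⟩ : Finset Y) : Set Y) := by
    intro x hx y hy hxy
    obtain ⟨i, rfl⟩ : ∃ i, g i = x := by simpa using hx
    obtain ⟨j, rfl⟩ : ∃ j, g j = y := by simpa using hy
    exact hg i j fun h => hxy (h ▸ rfl)
  refine le_trans ?_ (le_iSup₂_of_le _ hsep le_rfl)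
  simp

theorem coe_iterate_symmMap {X : Type*} [MetricSpace X] (f : X → X) (hf : Continuous f) (n k : ℕ)
    (A : SymmProd X n) :
    ((((symmMap f hf n)^[k] A).1 : NonemptyCompacts X) : Set X) = f^[k] '' (A.1 : Set X) := by
  induction k generalizing A with
  | zero => simp
  | succ k ih =>
    rw [Function.iterate_succ_apply, ih, Function.iterate_succ, Set.image_comp]
    rfl

theorem le_dist_of_mem_of_forall_le_dist {X : Type*} [MetricSpace X] {A B : NonemptyCompacts X}
    {ε : ℝ} {x : X} (hx : x ∈ A) (h : ∀ y ∈ B, ε ≤ dist x y) : ε ≤ dist A B := by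
  by_contra! hlt
  obtain ⟨y, hy, hxy⟩ := Metric.exists_dist_lt_of_hausdorffDist_lt (s := (A : Set X))
    (t := (B : Set X)) hx hlt
    (Metric.hausdorffEDist_ne_top_of_nonempty_of_bounded A.nonempty B.nonempty
      A.isCompact.isBounded B.isCompact.isBounded)
  exact absurd (h y hy) (not_le.2 hxy)

theorem IsWanderingPoint.exists_backward_orbit {X : Type*} [MetricSpace X] {f : X → X}
    (hf : Function.Surjective f) {p : X} (hp : IsWanderingPoint f p) :
    ∃ ε > 0, ∃ x : ℕ → X, (∀ j, f^[j] (x j) = p) ∧ ∀ i j, i ≠ j → ε ≤ dist p (f^[j] (x i)) := by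
  obtain ⟨U, hU, hpU, hw⟩ := hp
  obtain ⟨ε, hε, hball⟩ := Metric.isOpen_iff.1 hU p hpU
  obtain ⟨g, hg⟩ := hf.hasRightInverse
  have hx : ∀ j, f^[j] (g^[j] p) = p := fun j => hg.iterate j p
  have hret : ∀ y ∈ U, ∀ m, 1 ≤ m → f^[m] y ∉ U := fun y hy m hm hmem =>
    (hw m hm).subset ⟨mem_image_of_mem _ hy, hmem⟩
  refine ⟨ε, hε, fun j => g^[j] p, hx, fun i j hij => ?_⟩
  by_contra! hlt
  have hmem : f^[j] (g^[i] p) ∈ U := hball (by rwa [Metric.mem_ball, dist_comm])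
  rcases lt_or_gt_of_ne hij with h | h
  · refine hret p hpU (j - i) (by omega) ?_
    rwa [← hx i, ← Function.iterate_add_apply, Nat.sub_add_cancel h.le]
  · refine hret _ hmem (i - j) (by omega) ?_
    rwa [← Function.iterate_add_apply, Nat.sub_add_cancel h.le, hx i]

/-- The induced map on the symmetric product separates the `n`-point subsets of a backward orbit
of a wandering point. -/
theorem IsWanderingPoint.exists_choose_le_sepCount {X : Type*} [MetricSpace X] {f : X → X}
    (hf : Continuous f) (hsurj : Function.Surjective f) {p : X} (hp : IsWanderingPoint f p)
    {n : ℕ} (hn : 1 ≤ n) :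
    ∃ ε > 0, ∀ N : ℕ, (N.choose n : ℕ∞) ≤ sepCount (symmMap f hf n) N ε := by
  obtain ⟨ε, hε, x, hx, hsep⟩ := hp.exists_backward_orbit hsurj
  refine ⟨ε, hε, fun N => ?_⟩
  let ι := {S : Finset ℕ // S ∈ Finset.powersetCard n (Finset.range N)}
  have hcard (S : ι) : S.1.card = n := (Finset.mem_powersetCard.1 S.2).2
  have hne (S : ι) : (S.1 : Set ℕ).Nonempty :=
    Finset.coe_nonempty.2 <| Finset.card_pos.1 <| by rw [hcard]; omega
  let A : ι → SymmProd X n := fun S =>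
    ⟨⟨⟨x '' S.1, (S.1.finite_toSet.image x).isCompact⟩, (hne S).image x⟩,
      (Set.encard_image_le x _).trans (by rw [Set.encard_coe_eq_coe_finsetCard, hcard])⟩
  have hA : ∀ S T : ι, S ≠ T → ε ≤ dynDist (symmMap f hf n) N (A S) (A T) := by
    intro S T hST
    obtain ⟨j, hjS, hjT⟩ : ∃ j ∈ S.1, j ∉ T.1 := Finset.not_subset.1 fun hsub =>
      hST (Subtype.ext (Finset.eq_of_subset_of_card_le hsub (by rw [hcard, hcard])))
    have hjN : j < N := Finset.mem_range.1 ((Finset.mem_powersetCard.1 S.2).1 hjS)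
    refine le_trans ?_ (dist_iterate_le_dynDist _ hjN _ _)
    refine le_dist_of_mem_of_forall_le_dist (x := p) ?_ ?_
    · rw [← SetLike.mem_coe, coe_iterate_symmMap]
      exact ⟨x j, mem_image_of_mem x hjS, hx j⟩
    · intro y hy
      rw [← SetLike.mem_coe, coe_iterate_symmMap] at hy
      obtain ⟨_, ⟨i, hi, rfl⟩, rfl⟩ := hy
      exact hsep i j fun h => hjT (h ▸ hi)
  simpa [ι] using card_le_sepCount (symmMap f hf n) N hε A hA

theorem le_polGrowth_of_choose_le {u : ℕ → ℕ∞} {n : ℕ}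
    (hu : ∀ N : ℕ, (N.choose n : ℕ∞) ≤ u N) : (n : ℝ≥0∞) ≤ polGrowth u := by
  have hlog : Tendsto (fun N : ℕ => Real.log (N : ℝ)) atTop atTop :=
    Real.tendsto_log_atTop.comp tendsto_natCast_atTop_atTop
  set c : ℝ := 2 ^ n * n.factorial with hc
  have hc0 : 0 < c := by positivity
  have hlim : Tendsto (fun N : ℕ => (n : ℝ) - Real.log c / Real.log N) atTop (𝓝 n) := by
    simpa using (tendsto_const_nhds (x := (n : ℝ))).sub (hlog.const_div_atTop (Real.log c))
  have hlim' := (ENNReal.continuous_ofReal.tendsto (n : ℝ)).comp hlim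
  rw [ENNReal.ofReal_natCast] at hlim'
  rw [← hlim'.limsup_eq, polGrowth]
  refine limsup_le_limsup ?_
  filter_upwards [hlog.eventually_gt_atTop 0, eventually_ge_atTop (2 * n + 1)] with N hN hnN
  split_ifs with htop
  · exact le_top
  refine ENNReal.ofReal_le_ofReal ?_
  rw [le_div_iff₀ hN, sub_mul, div_mul_cancel₀ _ hN.ne']
  have hN0 : (0 : ℝ) < N := by exact_mod_cast (by omega : 0 < N)
  have hle : N.choose n ≤ (u N).toNat := by
    have := hu N
    rwa [← ENat.natCast_toNat htop, Nat.cast_le] at this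
  have hhalf : (N / 2 : ℝ) ≤ (N + 1 - n : ℕ) := by
    rw [div_le_iff₀ two_pos]
    exact_mod_cast (by omega : N ≤ (N + 1 - n) * 2)
  calc (n : ℝ) * Real.log N - Real.log c = Real.log ((N / 2 : ℝ) ^ n / n.factorial) := by
        rw [div_pow, div_div, ← hc, Real.log_div (pow_pos hN0 n).ne' hc0.ne', Real.log_pow]
    _ ≤ Real.log ((u N).toNat : ℝ) := by
        refine Real.log_le_log (by positivity) ?_
        calc (N / 2 : ℝ) ^ n / n.factorial ≤ ((N + 1 - n : ℕ) : ℝ) ^ n / n.factorial := by gcongr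
          _ ≤ N.choose n := Nat.pow_le_choose n N
          _ ≤ (u N).toNat := by exact_mod_cast hle

/-- if a homeomorphism `f` of a compact metric space has a wandering point, then
the induced map `F_n(f)` on the `n`-fold symmetric product satisfies `h_pol(F_n(f)) ≥ n`. -/
theorem le_hpol_symmMap_of_wandering
    {X : Type*} [MetricSpace X] [CompactSpace X]
    (f : X → X) (hf : IsHomeomorph f) (p : X) (hp : IsWanderingPoint f p)
    (n : ℕ) (hn : 1 ≤ n) :
    (n : ℝ≥0∞) ≤ hpol (symmMap f hf.continuous n) := by
  obtain ⟨ε, hε, h⟩ := hp.exists_choose_le_sepCount hf.continuous hf.surjective hn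
  exact le_iSup₂_of_le ε hε (le_polGrowth_of_choose_le h)
end

section
/- Let X be a local dendrite and f : X → X a homeomorphism without wandering points. Then for every n ≥ 1 the induced map F_n(f) on the n-fold symmetric product satisfies h_pol(F_n(f)) = 0. -/
open Filter Topology TopologicalSpace Set
open scoped ENNReal NNReal

variable {X : Type*}

/-- A subset `D` is a dendrite: a nonempty compact connected, locally connected subspace
containing no subspace homeomorphic to the circle. -/
def IsDendriteSet [TopologicalSpace X] (D : Set X) : Prop :=
  IsCompact D ∧ IsConnected D ∧ LocallyConnectedSpace D ∧
    ¬ ∃ S : Set D, Nonempty (S ≃ₜ (Metric.sphere (0 : ℂ) 1))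

/-- A local dendrite: every point has a neighbourhood which is a dendrite. (The requirement
that `X` be a continuum is imposed via instance arguments.) -/
def IsLocalDendrite (X : Type*) [TopologicalSpace X] : Prop :=
  ∀ x : X, ∃ D : Set X, D ∈ nhds x ∧ IsDendriteSet D

section LocalPathConnectedness

variable {Y : Type*} [MetricSpace Y]

/-- `a` and `b` lie in a common connected set of diameter at most `r`. -/
def LinkedAt (r : ℝ) (a b : Y) : Prop :=
  ∃ C : Set Y, IsPreconnected C ∧ a ∈ C ∧ b ∈ C ∧ ∀ u ∈ C, ∀ v ∈ C, dist u v ≤ r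

theorem LinkedAt.refl {r : ℝ} (hr : 0 ≤ r) (a : Y) : LinkedAt r a a :=
  ⟨{a}, isPreconnected_singleton, rfl, rfl, by simp [hr]⟩

theorem LinkedAt.dist_le {r : ℝ} {a b : Y} (h : LinkedAt r a b) : dist a b ≤ r := by
  obtain ⟨C, -, ha, hb, hC⟩ := h
  exact hC a ha b hb

theorem exists_linkedAt_of_dist_lt [CompactSpace Y] [LocallyConnectedSpace Y] {r : ℝ}
    (hr : 0 < r) : ∃ δ > 0, ∀ a b : Y, dist a b < δ → LinkedAt r a b := by
  have key : ∀ x : Y, ∃ V : Set Y, IsOpen V ∧ x ∈ V ∧ IsConnected V ∧ V ⊆ Metric.ball x (r / 2) :=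
    fun x => by
      obtain ⟨V, hV, h1, h2, h3⟩ := locallyConnectedSpace_iff_subsets_isOpen_isConnected.1
        inferInstance x (Metric.ball x (r / 2)) (Metric.ball_mem_nhds x (by positivity))
      exact ⟨V, h1, h2, h3, hV⟩
  choose V hVo hxV hVc hVs using key
  obtain ⟨δ, hδ, h⟩ := lebesgue_number_lemma_of_metric (isCompact_univ (X := Y)) hVo
    (fun x _ => mem_iUnion.2 ⟨x, hxV x⟩)
  refine ⟨δ, hδ, fun a b hab => ?_⟩
  obtain ⟨i, hi⟩ := h a (mem_univ a)
  refine ⟨V i, (hVc i).isPreconnected, hi (Metric.mem_ball_self hδ),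
    hi (by rwa [Metric.mem_ball, dist_comm]), fun u hu v hv => ?_⟩
  have h1 := hVs i hu
  have h2 := hVs i hv
  rw [Metric.mem_ball] at h1 h2
  linarith [dist_triangle_right u v i]

theorem exists_chain_of_transGen {α : Type*} {R : α → α → Prop} (hR : ∀ a, R a a) {a b : α}
    (h : Relation.ReflTransGen R a b) :
    ∃ (n : ℕ) (c : ℕ → α), c 0 = a ∧ (∀ j ≥ n, c j = b) ∧ ∀ j, R (c j) (c (j + 1)) := by
  induction h using Relation.ReflTransGen.head_induction_on with
  | refl => exact ⟨0, fun _ => b, rfl, fun _ _ => rfl, fun _ => hR b⟩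
  | @head a a' h1 _ ih =>
    obtain ⟨n, c, h0, hn, hc⟩ := ih
    refine ⟨n + 1, fun j => if j = 0 then a else c (j - 1), by simp, ?_, ?_⟩
    · rintro (_ | j) hj
      · omega
      · simpa using hn j (by omega)
    · rintro (_ | j)
      · simpa [h0] using h1
      · simpa using hc j

theorem LinkedAt.exists_chain [CompactSpace Y] [LocallyConnectedSpace Y] {r s : ℝ} (hs : 0 < s)
    {a b : Y} (h : LinkedAt r a b) :
    ∃ (n : ℕ) (c : ℕ → Y), c 0 = a ∧ (∀ j ≥ n, c j = b) ∧
      (∀ j, LinkedAt s (c j) (c (j + 1))) ∧ ∀ j, dist a (c j) ≤ r := by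
  obtain ⟨C, hC, ha, hb, hd⟩ := h
  obtain ⟨δ, hδ, hlink⟩ := exists_linkedAt_of_dist_lt (Y := Y) hs
  let R : C → C → Prop := fun u v => LinkedAt s (u : Y) v
  have : PreconnectedSpace C := Subtype.preconnectedSpace hC
  have hT : Relation.ReflTransGen R ⟨a, ha⟩ ⟨b, hb⟩ := by
    refine PreconnectedSpace.induction₂' (Relation.ReflTransGen R) (fun x => ?_)
      ⟨fun _ _ _ h1 h2 => h1.trans h2⟩ _ _
    filter_upwards [Metric.ball_mem_nhds x hδ] with y hy
    exact ⟨.single (hlink _ _ (by rw [dist_comm]; exact hy)), .single (hlink _ _ hy)⟩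
  obtain ⟨n, c, h0, hn, hc⟩ := exists_chain_of_transGen (R := R)
    (fun u => LinkedAt.refl hs.le (u : Y)) hT
  refine ⟨n, fun j => c j, by simp [h0], fun j hj => by simp [hn j hj], hc, fun j => ?_⟩
  exact hd _ ha _ (c j).2

/-- A finite chain from `x` to `y` all of whose links have size `r`. -/
structure LinkChain (x y : Y) (r : ℝ) where
  len : ℕ
  pt : ℕ → Y
  start : pt 0 = x
  finish : ∀ i ≥ len, pt i = y
  linked : ∀ i, LinkedAt r (pt i) (pt (i + 1))

theorem LinkChain.exists_refinement [CompactSpace Y] [LocallyConnectedSpace Y] {x y : Y} {r s : ℝ}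
    (hr : 0 < r) (hs : 0 < s) (P : LinkChain x y r) :
    ∃ (Q : LinkChain x y s) (N : ℕ), 0 < N ∧ Q.len = P.len * N ∧
      ∀ m, dist (P.pt (m / N)) (Q.pt m) ≤ r := by
  choose n c h0 hn hc hd using fun i => (P.linked i).exists_chain hs
  let N := (Finset.range P.len).sup n + 1
  have hN : 0 < N := Nat.succ_pos _
  have hnN : ∀ i < P.len, n i ≤ N := fun i hi =>
    (Finset.le_sup (f := n) (Finset.mem_range.2 hi)).trans (Nat.le_succ _)
  refine ⟨⟨P.len * N, fun m => if m / N < P.len then c (m / N) (m % N) else y, ?_, ?_, ?_⟩,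
    N, hN, rfl, ?_⟩
  · by_cases h : 0 < P.len
    · simp [h, h0, P.start]
    · have := P.finish 0 (by omega)
      simp [h, ← this, P.start]
  · intro i hi
    have : ¬ i / N < P.len := by
      rw [Nat.div_lt_iff_lt_mul hN]; omega
    simp [this]
  · intro m
    by_cases hm : m / N < P.len
    · have hlt := Nat.mod_lt m hN
      have hdm := Nat.div_add_mod m N
      rcases Nat.lt_or_ge (m % N + 1) N with h1 | h1
      · have e1 : (m + 1) / N = m / N := by
          rw [Nat.div_eq_iff hN, mul_comm]
          omega
        have e2 : (m + 1) % N = m % N + 1 := by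
          have := Nat.div_add_mod (m + 1) N
          rw [e1] at this; omega
        simp only [e1, e2, hm, if_true]
        exact hc _ _
      · have e0 : m + 1 = N * (m / N + 1) := by rw [mul_add]; omega
        have e1 : (m + 1) / N = m / N + 1 := by rw [e0, Nat.mul_div_cancel_left _ hN]
        have e2 : (m + 1) % N = 0 := by rw [e0, Nat.mul_mod_right]
        have e3 : c (m / N) (m % N + 1) = P.pt (m / N + 1) :=
          hn _ _ ((hnN _ hm).trans (by omega))
        have h2 := hc (m / N) (m % N)
        simp only [e1, e2, hm, if_true]
        rw [e3] at h2
        split_ifs with h3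
        · rwa [h0]
        · rwa [P.finish _ (by omega)] at h2
    · have : ¬ (m + 1) / N < P.len := by
        have := Nat.div_le_div_right (c := N) (Nat.le_succ m)
        simp only [Nat.succ_eq_add_one] at this
        omega
      simp only [hm, this, if_false]
      exact .refl hs.le _
  · intro m
    simp only
    split_ifs with h
    · exact hd _ _
    · rw [P.finish _ (by omega), dist_self]; exact hr.le

theorem LinkedAt.exists_path [CompactSpace Y] [LocallyConnectedSpace Y] {r : ℝ} (hr : 0 < r)
    {x y : Y} (h : LinkedAt r x y) :
    ∃ γ : ℝ → Y, Continuous γ ∧ γ 0 = x ∧ γ 1 = y ∧ ∀ t, dist x (γ t) ≤ 3 * r := by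
  have hpos : ∀ k : ℕ, 0 < r / 2 ^ k := fun k => by positivity
  have step : ∀ (k : ℕ) (P : LinkChain x y (r / 2 ^ k)),
      ∃ (Q : LinkChain x y (r / 2 ^ (k + 1))) (N : ℕ), 0 < N ∧ Q.len = P.len * N ∧
        ∀ m, dist (P.pt (m / N)) (Q.pt m) ≤ r / 2 ^ k :=
    fun k P => P.exists_refinement (hpos k) (hpos (k + 1))
  choose Q N hN hlen hdist using step
  let P0 : LinkChain x y (r / 2 ^ 0) :=
    ⟨1, fun i => if i = 0 then x else y, by simp, fun i hi => by
      rw [if_neg (by omega)], fun i => by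
      rcases i with _ | i
      · simpa using h
      · simpa using LinkedAt.refl hr.le y⟩
  let P : ∀ k, LinkChain x y (r / 2 ^ k) := fun k => Nat.rec P0 (fun k p => Q k p) k
  have hP : ∀ k, P (k + 1) = Q k (P k) := fun k => rfl
  let a : ℕ → ℝ → Y := fun k t => (P k).pt ⌊t * (P k).len⌋₊
  have ha : ∀ t k, dist (a k t) (a (k + 1) t) ≤ 2 * r / 2 / 2 ^ k := by
    intro t k
    have h1 := hdist k (P k) ⌊t * (P (k + 1)).len⌋₊
    have h2 : ⌊t * (P (k + 1)).len⌋₊ / N k (P k) = ⌊t * (P k).len⌋₊ := by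
      rw [← Nat.floor_div_natCast, hP, hlen]
      congr 1
      have : (N k (P k) : ℝ) ≠ 0 := by exact_mod_cast (hN k (P k)).ne'
      push_cast
      field_simp
    rw [h2] at h1
    have : 2 * r / 2 / 2 ^ k = r / 2 ^ k := by ring
    rw [this]
    exact h1
  choose γ hγ using fun t => cauchySeq_tendsto_of_complete (cauchySeq_of_le_geometric_two (ha t))
  have hclose : ∀ t k, dist (a k t) (γ t) ≤ 2 * r / 2 ^ k := fun t k =>
    dist_le_of_le_geometric_two_of_tendsto (ha t) (hγ t) k
  refine ⟨γ, ?_, ?_, ?_, fun t => ?_⟩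
  · rw [Metric.continuous_iff]
    intro t ε hε
    obtain ⟨k, hk⟩ : ∃ k : ℕ, 5 * r / 2 ^ k < ε := by
      obtain ⟨k, hk⟩ := exists_pow_lt_of_lt_one (show 0 < ε / (5 * r) by positivity)
        (show (1 / 2 : ℝ) < 1 by norm_num)
      refine ⟨k, ?_⟩
      rw [one_div, inv_pow, lt_div_iff₀ (by positivity)] at hk
      rw [div_eq_mul_inv]
      linarith
    refine ⟨1 / ((P k).len + 1), by positivity, fun s hst => ?_⟩
    have hfl : |s * (P k).len - t * (P k).len| < 1 := by
      rw [← sub_mul, abs_mul, Nat.abs_cast]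
      rw [Real.dist_eq, lt_div_iff₀ (by positivity)] at hst
      nlinarith [abs_nonneg (s - t)]
    rw [abs_lt] at hfl
    have hmono : ∀ u v : ℝ, u < v + 1 → ⌊u⌋₊ ≤ ⌊v⌋₊ + 1 := by
      intro u v huv
      refine Nat.lt_succ_iff.1 ?_
      by_cases hu : ⌊u⌋₊ = 0
      · omega
      rw [Nat.floor_lt' (by omega)]
      have := Nat.lt_floor_add_one v
      push_cast
      linarith
    have h1 := hmono (s * (P k).len) (t * (P k).len) (by linarith)
    have h2 := hmono (t * (P k).len) (s * (P k).len) (by linarith)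
    have h3 : dist (a k s) (a k t) ≤ r / 2 ^ k := by
      rcases Nat.lt_trichotomy ⌊s * (P k).len⌋₊ ⌊t * (P k).len⌋₊ with h | h | h
      · have := ((P k).linked ⌊s * (P k).len⌋₊).dist_le
        rwa [show ⌊s * (P k).len⌋₊ + 1 = ⌊t * (P k).len⌋₊ by omega] at this
      · simp only [a, h, dist_self]; exact (hpos k).le
      · have := ((P k).linked ⌊t * (P k).len⌋₊).dist_le
        rwa [show ⌊t * (P k).len⌋₊ + 1 = ⌊s * (P k).len⌋₊ by omega, dist_comm] at this
    have h4 := hclose s k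
    have h5 := hclose t k
    calc dist (γ s) (γ t) ≤ dist (a k s) (γ s) + dist (a k s) (a k t) + dist (a k t) (γ t) := by
          rw [dist_comm (a k s) (γ s)]
          exact dist_triangle4 _ _ _ _
      _ ≤ 5 * r / 2 ^ k := by
          have : 5 * r / 2 ^ k = 2 * r / 2 ^ k + r / 2 ^ k + 2 * r / 2 ^ k := by ring
          linarith
      _ < ε := hk
  · refine tendsto_nhds_unique (hγ 0) ?_
    simp [a, (P _).start]
  · refine tendsto_nhds_unique (hγ 1) ?_
    simp [a, (P _).finish]
  · have h1 := hclose t 0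
    have h2 : dist x (a 0 t) ≤ r := by
      change dist x (if _ then x else y) ≤ r
      split_ifs
      · simpa using hr.le
      · exact h.dist_le
    have := dist_triangle x (a 0 t) (γ t)
    simp only [pow_zero, div_one] at h1
    linarith

theorem locallyPathConnectedSpace_of_compact_of_locallyConnected (Y : Type*) [MetricSpace Y]
    [CompactSpace Y] [LocallyConnectedSpace Y] : LocallyPathConnectedSpace Y := by
  rw [locallyPathConnectedSpace_iff_pathComponentIn_mem_nhds]
  intro x u hu hxu
  obtain ⟨ε, hε, hball⟩ := Metric.isOpen_iff.1 hu x hxu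
  obtain ⟨δ, hδ, hlink⟩ := exists_linkedAt_of_dist_lt (Y := Y) (r := ε / 4) (by positivity)
  filter_upwards [Metric.ball_mem_nhds x hδ] with y hy
  obtain ⟨γ, hγ, h0, h1, hd⟩ := (hlink x y (by rwa [dist_comm])).exists_path (by positivity)
  refine JoinedIn.ofLine hγ.continuousOn h0 h1 ?_
  rintro _ ⟨t, -, rfl⟩
  apply hball
  rw [Metric.mem_ball, dist_comm]
  linarith [hd t]

end LocalPathConnectedness

section Arcs

variable {Y : Type*} [MetricSpace Y]

theorem IsClosed.exists_greatest_le {K : Set ℝ} (hK : IsClosed K) {v t : ℝ} (hv : v ∈ K)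
    (hvt : v ≤ t) : ∃ l ∈ K, v ≤ l ∧ l ≤ t ∧ ∀ w ∈ K, w ≤ t → w ≤ l := by
  obtain ⟨l, ⟨hlK, hl1, hl2⟩, hl⟩ := (isCompact_Icc.inter_left hK).exists_isGreatest
    (s := K ∩ Icc v t) ⟨v, hv, le_rfl, hvt⟩
  refine ⟨l, hlK, hl1, hl2, fun w hw hwt => ?_⟩
  rcases le_total v w with h | h
  · exact hl ⟨hw, h, hwt⟩
  · exact h.trans hl1

theorem IsClosed.exists_least_ge {K : Set ℝ} (hK : IsClosed K) {v t : ℝ} (hv : v ∈ K)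
    (hvt : t ≤ v) : ∃ l ∈ K, l ≤ v ∧ t ≤ l ∧ ∀ w ∈ K, t ≤ w → l ≤ w := by
  obtain ⟨l, ⟨hlK, hl1, hl2⟩, hl⟩ := (isCompact_Icc.inter_left hK).exists_isLeast
    (s := K ∩ Icc t v) ⟨v, hv, hvt, le_rfl⟩
  refine ⟨l, hlK, hl2, hl1, fun w hw hwt => ?_⟩
  rcases le_total w v with h | h
  · exact hl ⟨hw, hwt, h⟩
  · exact hl2.trans h

/-- Closed subsets of `[0, 1]` containing the endpoints such that `γ` takes the same value at
both ends of each complementary gap. -/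
def GapClosed (γ : ℝ → Y) (K : Set ℝ) : Prop :=
  IsClosed K ∧ K ⊆ Icc 0 1 ∧ (0 : ℝ) ∈ K ∧ (1 : ℝ) ∈ K ∧
    ∀ s ∈ K, ∀ t ∈ K, s < t → Ioo s t ∩ K = ∅ → γ s = γ t

theorem exists_minimal_gapClosed {γ : ℝ → Y} (hγ : Continuous γ) :
    ∃ K, Minimal (fun K => K ∈ {K | GapClosed γ K}) K := by
  refine zorn_superset _ fun c hc hchain => ?_
  rcases c.eq_empty_or_nonempty with rfl | hne
  · refine ⟨Icc 0 1, ⟨isClosed_Icc, subset_rfl, by simp, by simp, ?_⟩, by simp⟩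
    intro s hs t ht hst he
    exfalso
    have : (s + t) / 2 ∈ Ioo s t ∩ Icc 0 1 :=
      ⟨⟨by linarith, by linarith⟩, by linarith [hs.1, ht.1], by linarith [hs.2, ht.2]⟩
    rw [he] at this
    exact this
  refine ⟨⋂₀ c, ⟨isClosed_sInter fun K hK => (hc hK).1, ?_, fun K hK => (hc hK).2.2.1,
    fun K hK => (hc hK).2.2.2.1, ?_⟩, fun s hs => sInter_subset_of_mem hs⟩
  · obtain ⟨K, hK⟩ := hne
    exact (sInter_subset_of_mem hK).trans (hc hK).2.1
  intro s hs t ht hst he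
  refine dist_le_zero.1 (le_of_forall_pos_le_add fun ε hε => ?_)
  obtain ⟨δ₁, hδ₁, h1⟩ := Metric.continuous_iff.1 hγ s (ε / 2) (by positivity)
  obtain ⟨δ₂, hδ₂, h2⟩ := Metric.continuous_iff.1 hγ t (ε / 2) (by positivity)
  obtain ⟨η, hη, hη'⟩ : ∃ η > 0, η < δ₁ ∧ η < δ₂ ∧ s + η < t - η := by
    refine ⟨min (min δ₁ δ₂) (t - s) / 3, ?_, ?_, ?_, ?_⟩
    · have := sub_pos.2 hst; positivity
    all_goals
      have := sub_pos.2 hst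
      have h3 := min_le_left (min δ₁ δ₂) (t - s)
      have h4 := min_le_right (min δ₁ δ₂) (t - s)
      have h5 := min_le_left δ₁ δ₂
      have h6 := min_le_right δ₁ δ₂
      have : 0 < min (min δ₁ δ₂) (t - s) := by positivity
      linarith
  obtain ⟨C, hCc, hC⟩ : ∃ C ∈ c, C ∩ Icc (s + η) (t - η) = ∅ := by
    by_contra! hcon
    have : Nonempty c := hne.to_subtype
    have := IsCompact.nonempty_iInter_of_directed_nonempty_isCompact_isClosed
      (fun C : c => (C : Set ℝ) ∩ Icc (s + η) (t - η)) ?_ (fun C => hcon C C.2)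
      (fun C => isCompact_Icc.inter_left (hc C.2).1) (fun C => (hc C.2).1.inter isClosed_Icc)
    · obtain ⟨v, hv⟩ := this
      rw [mem_iInter] at hv
      have h3 := (hv (Classical.arbitrary _)).2
      have : v ∈ Ioo s t ∩ ⋂₀ c :=
        ⟨⟨by linarith [h3.1], by linarith [h3.2]⟩, fun K hK => (hv ⟨K, hK⟩).1⟩
      rw [he] at this
      exact this
    · intro A B
      rcases hchain.total A.2 B.2 with h | h
      · exact ⟨A, subset_rfl, inter_subset_inter_left _ h⟩
      · exact ⟨B, inter_subset_inter_left _ h, subset_rfl⟩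
  obtain ⟨l, hlC, hl1, hl2, hl⟩ := (hc hCc).1.exists_greatest_le (hs C hCc)
    (show s ≤ s + η by linarith)
  obtain ⟨r, hrC, hr1, hr2, hr⟩ := (hc hCc).1.exists_least_ge (ht C hCc)
    (show t - η ≤ t by linarith)
  have hlr : γ l = γ r := by
    refine (hc hCc).2.2.2.2 l hlC r hrC (by linarith) (eq_empty_of_forall_notMem ?_)
    rintro v ⟨⟨hv1, hv2⟩, hvC⟩
    have h3 : s + η < v := lt_of_not_ge fun h => (hl v hvC h).not_gt hv1
    have h4 : v < t - η := lt_of_not_ge fun h => (hr v hvC h).not_gt hv2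
    have : v ∈ C ∩ Icc (s + η) (t - η) := ⟨hvC, h3.le, h4.le⟩
    rw [hC] at this
    exact this
  have h3 := h1 l (by rw [Real.dist_eq, abs_lt]; constructor <;> linarith)
  have h4 := h2 r (by rw [Real.dist_eq, abs_lt]; constructor <;> linarith)
  have := dist_triangle_left (γ s) (γ t) (γ l)
  rw [← hlr] at h4
  linarith

/-- Every path can be replaced by one, inside the original path, whose fibres are intervals. -/
theorem exists_monotone_path {γ : ℝ → Y} (hγ : Continuous γ) :
    ∃ σ : ℝ → Y, ContinuousOn σ (Icc 0 1) ∧ σ 0 = γ 0 ∧ σ 1 = γ 1 ∧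
      (∀ t ∈ Icc (0 : ℝ) 1, σ t ∈ γ '' Icc 0 1) ∧
      ∀ s ∈ Icc (0 : ℝ) 1, ∀ t ∈ Icc (0 : ℝ) 1, s < t → σ s = σ t →
        ∀ u ∈ Icc s t, σ u = σ s := by
  obtain ⟨K, ⟨hKc, hK01, h0, h1, hgap⟩, hmin⟩ := exists_minimal_gapClosed hγ
  have hl : ∀ t : ℝ, ∃ l, t ∈ Icc (0 : ℝ) 1 → l ∈ K ∧ l ≤ t ∧ ∀ w ∈ K, w ≤ t → w ≤ l := by
    intro t
    by_cases ht : t ∈ Icc (0 : ℝ) 1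
    · obtain ⟨l, h1, h2, h3, h4⟩ := hKc.exists_greatest_le h0 ht.1
      exact ⟨l, fun _ => ⟨h1, h3, h4⟩⟩
    · exact ⟨0, fun h => absurd h ht⟩
  have hr : ∀ t : ℝ, ∃ l, t ∈ Icc (0 : ℝ) 1 → l ∈ K ∧ t ≤ l ∧ ∀ w ∈ K, t ≤ w → l ≤ w := by
    intro t
    by_cases ht : t ∈ Icc (0 : ℝ) 1
    · obtain ⟨l, h1, h2, h3, h4⟩ := hKc.exists_least_ge h1 ht.2
      exact ⟨l, fun _ => ⟨h1, h3, h4⟩⟩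
    · exact ⟨0, fun h => absurd h ht⟩
  choose l hl using hl
  choose r hr using hr
  have hlr : ∀ t ∈ Icc (0 : ℝ) 1, γ (l t) = γ (r t) := by
    intro t ht
    obtain ⟨a1, a2, a3⟩ := hl t ht
    obtain ⟨b1, b2, b3⟩ := hr t ht
    rcases (a2.trans b2).eq_or_lt with h | h
    · rw [h]
    · refine hgap _ a1 _ b1 h (eq_empty_of_forall_notMem ?_)
      rintro v ⟨⟨hv1, hv2⟩, hvK⟩
      rcases le_total v t with h' | h'
      · exact (a3 v hvK h').not_gt hv1
      · exact (b3 v hvK h').not_gt hv2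
  -- on an interval either `l` is constant, or its image is sandwiched by points of `K`
  have hcases : ∀ s ∈ Icc (0 : ℝ) 1, ∀ t ∈ Icc (0 : ℝ) 1, s ≤ t → l s = l t ∨
      (s ≤ r s ∧ r s ≤ l t ∧ l t ≤ t) := by
    intro s hs t ht hst
    obtain ⟨a1, a2, a3⟩ := hl s hs
    obtain ⟨b1, b2, b3⟩ := hr s hs
    obtain ⟨c1, c2, c3⟩ := hl t ht
    rcases le_or_gt (r s) t with h | h
    · exact Or.inr ⟨b2, c3 _ b1 h, c2⟩
    · refine Or.inl (le_antisymm (c3 _ a1 (a2.trans hst)) (a3 _ c1 (le_of_not_gt fun h' => ?_)))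
      exact ((b3 _ c1 h'.le).trans c2).not_gt h
  refine ⟨fun t => γ (l t), ?_, ?_, ?_, ?_, ?_⟩
  · have hu := isCompact_Icc.uniformContinuousOn_of_continuous (hγ.continuousOn (s := Icc 0 1))
    rw [Metric.uniformContinuousOn_iff] at hu
    rw [Metric.continuousOn_iff]
    have key : ∀ ε δ : ℝ, 0 < ε → (∀ x ∈ Icc (0 : ℝ) 1, ∀ y ∈ Icc (0 : ℝ) 1, dist x y < δ →
        dist (γ x) (γ y) < ε) → ∀ s ∈ Icc (0 : ℝ) 1, ∀ t ∈ Icc (0 : ℝ) 1, s ≤ t →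
        dist s t < δ → dist (γ (l s)) (γ (l t)) < ε := by
      intro ε δ hε hδ s hs t ht hst hd
      rcases hcases s hs t ht hst with h | ⟨h1, h2, h3⟩
      · rw [h, dist_self]; exact hε
      · rw [hlr s hs]
        refine hδ _ (hK01 (hr s hs).1) _ (hK01 (hl t ht).1) ?_
        rw [Real.dist_eq, abs_lt] at hd ⊢
        constructor <;> linarith
    intro t ht ε hε
    obtain ⟨δ, hδ, h⟩ := hu ε hε
    refine ⟨δ, hδ, fun s hs hst => ?_⟩
    rcases le_total s t with h' | h'
    · exact key ε δ hε h s hs t ht h' hst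
    · rw [dist_comm]
      exact key ε δ hε h t ht s hs h' (by rwa [dist_comm])
  · have h2 := hl 0 (by simp)
    have h3 := hK01 h2.1
    simp only [le_antisymm h2.2.1 h3.1]
  · have h2 := hl 1 (by simp)
    have h3 := h2.2.2 1 h1 le_rfl
    simp only [le_antisymm h2.2.1 h3]
  · exact fun t ht => ⟨l t, hK01 (hl t ht).1, rfl⟩
  · intro s hs t ht hst heq u hu
    have hu01 : u ∈ Icc (0 : ℝ) 1 := ⟨hs.1.trans hu.1, hu.2.trans ht.2⟩
    simp only at heq ⊢
    rcases hcases s hs t ht hst.le with h | ⟨h1, h2, h3⟩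
    · have : l u = l s := by
        refine le_antisymm ?_ ((hl u hu01).2.2 _ (hl s hs).1 ((hl s hs).2.1.trans hu.1))
        rw [h]
        exact (hl t ht).2.2 _ (hl u hu01).1 ((hl u hu01).2.1.trans hu.2)
      rw [this]
    · have hempty : ∀ v ∈ K, r s < v → l t ≤ v := by
        intro v hv hrv
        by_contra! hvt
        have hsub : GapClosed γ (K \ Ioo (r s) (l t)) := by
          refine ⟨hKc.sdiff isOpen_Ioo, sdiff_subset.trans hK01, ⟨h0, fun h => ?_⟩,
            ⟨‹(1:ℝ) ∈ K›, fun h => ?_⟩, ?_⟩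
          · exact (hK01 (hr s hs).1).1.not_gt h.1
          · exact (hK01 (hl t ht).1).2.not_gt h.2
          · rintro a ⟨ha, ha'⟩ b ⟨hb, hb'⟩ hab he
            have hrs : r s ∈ K \ Ioo (r s) (l t) := ⟨(hr s hs).1, fun h => lt_irrefl _ h.1⟩
            have hlt : l t ∈ K \ Ioo (r s) (l t) := ⟨(hl t ht).1, fun h => lt_irrefl _ h.2⟩
            have e1 : ¬ (a < r s ∧ r s < b) := fun h => by
              have : r s ∈ Ioo a b ∩ (K \ Ioo (r s) (l t)) := ⟨h, hrs⟩
              rw [he] at this; exact this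
            have e2 : ¬ (a < l t ∧ l t < b) := fun h => by
              have : l t ∈ Ioo a b ∩ (K \ Ioo (r s) (l t)) := ⟨h, hlt⟩
              rw [he] at this; exact this
            by_cases hab' : a ≤ r s ∧ l t ≤ b
            · have ea : a = r s := by
                by_contra hne
                exact e1 ⟨lt_of_le_of_ne hab'.1 hne, by linarith⟩
              have eb : b = l t := by
                by_contra hne
                exact e2 ⟨by linarith, lt_of_le_of_ne hab'.2 (Ne.symm hne)⟩
              rw [ea, eb, ← hlr s hs, heq]
            · refine hgap a ha b hb hab (eq_empty_of_forall_notMem ?_)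
              rintro w ⟨hw, hwK⟩
              have hw' : w ∈ Ioo (r s) (l t) := by
                by_contra hw'
                have : w ∈ Ioo a b ∩ (K \ Ioo (r s) (l t)) := ⟨hw, hwK, hw'⟩
                rw [he] at this; exact this
              simp only [mem_Ioo, not_and_or, not_lt] at ha' hb' e1 e2 hab' hw hw'
              rcases ha' with ha' | ha'
              · rcases hb' with hb' | hb'
                · linarith [hw.1, hw.2, hw'.1, hw'.2]
                · exact hab' |>.elim (fun h => h ha') (fun h => h hb')
              · linarith [hw.1, hw.2, hw'.1, hw'.2]
        exact (hmin hsub sdiff_subset hv).2 ⟨hrv, hvt⟩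
      obtain ⟨c1, c2, c3⟩ := hl u hu01
      rcases le_or_gt (r s) (l u) with h4 | h4
      · rcases h4.eq_or_lt with h5 | h5
        · rw [← h5, hlr s hs]
        · have h6 := hempty _ c1 h5
          have h7 := (hl t ht).2.2 _ c1 (c2.trans hu.2)
          rw [le_antisymm h7 h6, heq]
      · have h5 : l u = l s := by
          refine le_antisymm ((hl s hs).2.2 _ c1 (le_of_not_gt fun h => ?_))
            (c3 _ (hl s hs).1 ((hl s hs).2.1.trans hu.1))
          exact ((hr s hs).2.2 _ c1 h.le).not_gt h4
        rw [h5]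

end Arcs

section ArcExistence

variable {Y : Type*} [MetricSpace Y]

theorem infDist_image_Icc_le {σ : ℝ → Y} {y : Y} {s t ε : ℝ} (hs : 0 ≤ s)
    (h : ∀ v ∈ Icc s t, dist (σ s) (σ v) ≤ ε) (hε : 0 ≤ ε) (ht : 0 ≤ t) :
    Metric.infDist y (σ '' Icc 0 s) ≤ Metric.infDist y (σ '' Icc 0 t) + ε := by
  rw [← sub_le_iff_le_add]
  refine (Metric.le_infDist ((nonempty_Icc.2 ht).image σ)).2 ?_
  rintro _ ⟨v, hv, rfl⟩
  rcases le_total v s with hvs | hvs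
  · have := Metric.infDist_le_dist_of_mem (x := y) (mem_image_of_mem σ (show v ∈ Icc 0 s from ⟨hv.1, hvs⟩))
    linarith
  · have := Metric.infDist_le_dist_of_mem (x := y) (mem_image_of_mem σ (show s ∈ Icc 0 s from ⟨hs, le_rfl⟩))
    have h2 := h v ⟨hvs, hv.2⟩
    have h3 := dist_triangle_right y (σ s) (σ v)
    linarith

theorem continuousOn_infDist_image_Icc {σ : ℝ → Y} (hσ : ContinuousOn σ (Icc 0 1)) (y : Y) :
    ContinuousOn (fun t => Metric.infDist y (σ '' Icc 0 t)) (Icc 0 1) := by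
  have hu := isCompact_Icc.uniformContinuousOn_of_continuous hσ
  rw [Metric.uniformContinuousOn_iff] at hu
  rw [Metric.continuousOn_iff]
  intro t ht ε hε
  obtain ⟨δ, hδ, h⟩ := hu (ε / 2) (half_pos hε)
  have key : ∀ a ∈ Icc (0 : ℝ) 1, ∀ b ∈ Icc (0 : ℝ) 1, dist a b < δ →
      Metric.infDist y (σ '' Icc 0 a) ≤ Metric.infDist y (σ '' Icc 0 b) + ε / 2 := by
    intro a ha b hb hab
    refine infDist_image_Icc_le ha.1 (fun v hv => (h a ha v ⟨ha.1.trans hv.1, hv.2.trans hb.2⟩ ?_).le)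
      (half_pos hε).le hb.1
    rw [Real.dist_eq, abs_lt] at *
    constructor <;> linarith [hv.1, hv.2]
  refine ⟨δ, hδ, fun s hs hst => ?_⟩
  have h1 := key s hs t ht hst
  have h2 := key t ht s hs (by rwa [dist_comm])
  rw [Real.dist_eq, abs_lt]
  constructor <;> linarith

theorem exists_antitone_separating [CompactSpace Y] {σ : ℝ → Y} (hσ : ContinuousOn σ (Icc 0 1))
    (hm : ∀ s ∈ Icc (0 : ℝ) 1, ∀ t ∈ Icc (0 : ℝ) 1, s < t → σ s = σ t → ∀ u ∈ Icc s t, σ u = σ s) :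
    ∃ φ : ℝ → ℝ, ContinuousOn φ (Icc 0 1) ∧ AntitoneOn φ (Icc 0 1) ∧
      ∀ s ∈ Icc (0 : ℝ) 1, ∀ t ∈ Icc (0 : ℝ) 1, s ≤ t → (φ s = φ t ↔ σ s = σ t) := by
  have : Nonempty Y := ⟨σ 0⟩
  set D : ℕ → ℝ → ℝ := fun i t => Metric.infDist (denseSeq Y i) (σ '' Icc 0 t) with hD
  set M := Metric.diam (univ : Set Y)
  have hb : ∀ i, ∀ t ∈ Icc (0 : ℝ) 1, ‖(1 / 2 : ℝ) ^ i * D i t‖ ≤ (1 / 2 : ℝ) ^ i * M := by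
    intro i t ht
    rw [norm_mul, norm_pow, Real.norm_of_nonneg (show (0 : ℝ) ≤ 1 / 2 by norm_num),
      Real.norm_of_nonneg Metric.infDist_nonneg]
    gcongr
    refine (Metric.infDist_le_dist_of_mem (mem_image_of_mem σ (show (0 : ℝ) ∈ Icc 0 t from ⟨le_rfl, ht.1⟩))).trans ?_
    exact Metric.dist_le_diam_of_mem isCompact_univ.isBounded (mem_univ _) (mem_univ _)
  have hsum : Summable fun i => (1 / 2 : ℝ) ^ i * M :=
    (summable_geometric_of_lt_one (by norm_num) (by norm_num)).mul_right M
  have hsm : ∀ t ∈ Icc (0 : ℝ) 1, Summable fun i => (1 / 2 : ℝ) ^ i * D i t := fun t ht =>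
    Summable.of_norm_bounded hsum (fun i => hb i t ht)
  have hanti : ∀ i, ∀ s ∈ Icc (0 : ℝ) 1, ∀ t, s ≤ t → D i t ≤ D i s := fun i s hs t hst =>
    Metric.infDist_le_infDist_of_subset (image_mono (Icc_subset_Icc_right hst))
      ⟨σ 0, mem_image_of_mem σ ⟨le_rfl, hs.1⟩⟩
  refine ⟨fun t => ∑' i, (1 / 2 : ℝ) ^ i * D i t, ?_, ?_, ?_⟩
  · exact continuousOn_tsum (fun i => continuousOn_const.mul
      (continuousOn_infDist_image_Icc hσ _)) hsum hb
  · intro s hs t ht hst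
    refine Summable.tsum_le_tsum (fun i => ?_) (hsm t ht) (hsm s hs)
    exact mul_le_mul_of_nonneg_left (hanti i s hs t hst) (by positivity)
  · intro s hs t ht hst
    constructor
    · contrapose!
      intro hne
      have hnot : σ t ∉ σ '' Icc 0 s := by
        rintro ⟨v, hv, hvt⟩
        have hvs : v < t := lt_of_le_of_ne (hv.2.trans hst) (by
          rintro rfl
          exact hne (by rw [le_antisymm hst hv.2]))
        have hv1 : v ∈ Icc (0 : ℝ) 1 := ⟨hv.1, hvs.le.trans ht.2⟩
        exact hne ((hm v hv1 t ht hvs hvt s ⟨hv.2, hst⟩).trans hvt)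
      have hcl : IsClosed (σ '' Icc 0 s) :=
        (isCompact_Icc.image_of_continuousOn (hσ.mono (Icc_subset_Icc_right hs.2))).isClosed
      have hne' : (σ '' Icc 0 s).Nonempty := ⟨σ 0, mem_image_of_mem σ ⟨le_rfl, hs.1⟩⟩
      have he := (hcl.notMem_iff_infDist_pos hne').1 hnot
      obtain ⟨i, hi⟩ := (denseRange_denseSeq Y).exists_dist_lt (σ t) (half_pos he)
      have h1 : D i t < D i s := by
        have h2 : D i t ≤ dist (denseSeq Y i) (σ t) :=
          Metric.infDist_le_dist_of_mem (mem_image_of_mem σ ⟨ht.1, le_rfl⟩)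
        have h3 := Metric.infDist_le_infDist_add_dist (s := σ '' Icc 0 s) (x := σ t)
          (y := denseSeq Y i)
        rw [dist_comm] at h2
        simp only [hD] at *
        linarith
      refine (Summable.tsum_lt_tsum (i := i) (fun j => ?_) ?_ (hsm t ht) (hsm s hs)).ne'
      · exact mul_le_mul_of_nonneg_left (hanti j s hs t hst) (by positivity)
      · exact mul_lt_mul_of_pos_left h1 (by positivity)
    · intro heq
      rcases hst.eq_or_lt with rfl | hlt
      · rfl
      have himg : σ '' Icc 0 s = σ '' Icc 0 t := by
        refine (image_mono (Icc_subset_Icc_right hst)).antisymm ?_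
        rintro _ ⟨v, hv, rfl⟩
        rcases le_total v s with h | h
        · exact ⟨v, ⟨hv.1, h⟩, rfl⟩
        · exact ⟨s, ⟨hs.1, le_rfl⟩, (hm s hs t ht hlt heq v ⟨h, hv.2⟩).symm⟩
      simp only [hD, himg]

theorem exists_arc_of_path [CompactSpace Y] {γ : ℝ → Y} (hγ : Continuous γ) (hne : γ 0 ≠ γ 1) :
    ∃ α : ℝ → Y, Continuous α ∧ InjOn α (Icc 0 1) ∧ α 0 = γ 0 ∧ α 1 = γ 1 ∧
      ∀ t, α t ∈ γ '' Icc 0 1 := by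
  obtain ⟨σ, hσ, h0, h1, hr, hm⟩ := exists_monotone_path hγ
  obtain ⟨φ, hφ, hanti, hiff⟩ := exists_antitone_separating hσ hm
  have h01 : (0 : ℝ) ∈ Icc (0 : ℝ) 1 := ⟨le_rfl, zero_le_one⟩
  have h11 : (1 : ℝ) ∈ Icc (0 : ℝ) 1 := ⟨zero_le_one, le_rfl⟩
  have hφne : φ 1 < φ 0 := by
    refine lt_of_le_of_ne (hanti h01 h11 zero_le_one) fun h => hne ?_
    rw [← h0, ← h1]
    exact (hiff 0 h01 1 h11 zero_le_one).1 h.symm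
  have hd : 0 < φ 0 - φ 1 := sub_pos.2 hφne
  set ψ : ℝ → ℝ := fun t => (φ 0 - φ t) / (φ 0 - φ 1) with hψ
  have hψc : ContinuousOn ψ (Icc 0 1) := (continuousOn_const.sub hφ).div_const _
  have hψ0 : ψ 0 = 0 := by simp [hψ]
  have hψ1 : ψ 1 = 1 := by simp [hψ, hd.ne']
  have hmaps : ∀ t ∈ Icc (0 : ℝ) 1, ψ t ∈ Icc (0 : ℝ) 1 := by
    intro t ht
    have a1 := hanti h01 ht ht.1
    have a2 := hanti ht h11 ht.2
    exact ⟨div_nonneg (by linarith) hd.le, (div_le_one hd).2 (by linarith)⟩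
  have hψiff : ∀ s ∈ Icc (0 : ℝ) 1, ∀ t ∈ Icc (0 : ℝ) 1, (ψ s = ψ t ↔ σ s = σ t) := by
    have : ∀ s t, ψ s = ψ t ↔ φ s = φ t := by
      intro s t
      rw [hψ]
      simp only
      rw [div_left_inj' hd.ne', sub_right_inj]
    intro s hs t ht
    rw [this]
    rcases le_total s t with h | h
    · exact hiff s hs t ht h
    · rw [eq_comm, hiff t ht s hs h, eq_comm]
  let Ψ : Icc (0 : ℝ) 1 → Icc (0 : ℝ) 1 := fun t => ⟨ψ t, hmaps t t.2⟩
  have hΨc : Continuous Ψ := Continuous.subtype_mk (continuousOn_iff_continuous_domRestrict.1 hψc) _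
  have hΨs : Function.Surjective Ψ := by
    rintro ⟨u, hu⟩
    have := intermediate_value_Icc zero_le_one hψc
    rw [hψ0, hψ1] at this
    obtain ⟨t, ht, rfl⟩ := this hu
    exact ⟨⟨t, ht⟩, rfl⟩
  have hq : IsQuotientMap Ψ := hΨc.isClosedMap.isQuotientMap hΨc hΨs
  set τ := Function.surjInv hΨs
  have hτ : ∀ u, Ψ (τ u) = u := Function.surjInv_eq hΨs
  let g : Icc (0 : ℝ) 1 → Y := fun u => σ (τ u)
  have hgΨ : ∀ t, g (Ψ t) = σ t := fun t => by
    refine (hψiff _ (τ (Ψ t)).2 _ t.2).1 ?_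
    exact congrArg Subtype.val (hτ (Ψ t))
  have hg : Continuous g := by
    rw [hq.continuous_iff]
    have : g ∘ Ψ = (Icc (0 : ℝ) 1).domRestrict σ := funext hgΨ
    rw [this]
    exact continuousOn_iff_continuous_domRestrict.1 hσ
  refine ⟨IccExtend zero_le_one g, hg.Icc_extend', ?_, ?_, ?_, ?_⟩
  · intro u hu v hv huv
    rw [IccExtend_of_mem _ _ hu, IccExtend_of_mem _ _ hv] at huv
    have h := (hψiff _ (τ ⟨u, hu⟩).2 _ (τ ⟨v, hv⟩).2).2 huv
    have hu' := congrArg Subtype.val (hτ ⟨u, hu⟩)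
    have hv' := congrArg Subtype.val (hτ ⟨v, hv⟩)
    exact hu'.symm.trans (h.trans hv')
  · rw [IccExtend_of_mem _ _ h01, ← h0]
    have : (⟨0, h01⟩ : Icc (0 : ℝ) 1) = Ψ ⟨0, h01⟩ := Subtype.ext hψ0.symm
    rw [this, hgΨ]
  · rw [IccExtend_of_mem _ _ h11, ← h1]
    have : (⟨1, h11⟩ : Icc (0 : ℝ) 1) = Ψ ⟨1, h11⟩ := Subtype.ext hψ1.symm
    rw [this, hgΨ]
  · intro t
    exact hr _ (τ _).2

end ArcExistence

section Separation

variable {Y : Type*} [MetricSpace Y]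

/-- `Y` contains no simple closed curve. -/
def CircleFree (Y : Type*) [TopologicalSpace Y] : Prop :=
  ¬ ∃ S : Set Y, Nonempty (S ≃ₜ (Metric.sphere (0 : ℂ) 1))

theorem CircleFree.not_injOn_loop (hY : CircleFree Y) {l : ℝ → Y} (hl : ContinuousOn l (Icc 0 2))
    (h02 : l 0 = l 2) : ¬ InjOn l (Ico 0 2) := by
  intro hi
  have : Fact ((0 : ℝ) < 2) := ⟨two_pos⟩
  have hc := AddCircle.liftIco_zero_continuous h02 hl
  have hinj : Function.Injective (AddCircle.liftIco (2 : ℝ) 0 l) := by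
    intro x y hxy
    have hx := ((AddCircle.equivIco (2 : ℝ) 0) x).2
    have hy := ((AddCircle.equivIco (2 : ℝ) 0) y).2
    have := hi (by simpa using hx) (by simpa using hy) hxy
    exact (AddCircle.equivIco (2 : ℝ) 0).injective (Subtype.ext this)
  have he := hc.isClosedEmbedding hinj
  have e1 : AddCircle (2 : ℝ) ≃ₜ Metric.sphere (0 : ℂ) 1 :=
    (AddCircle.homeomorphCircle two_ne_zero).trans (Homeomorph.refl Circle)
  exact hY ⟨_, ⟨he.isEmbedding.toHomeomorph.symm.trans e1⟩⟩

theorem exists_arc_mem_of_isOpen [CompactSpace Y] [LocallyConnectedSpace Y] {U : Set Y}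
    (hU : IsOpen U) (hc : IsPreconnected U) {a b : Y} (ha : a ∈ U) (hb : b ∈ U) (hab : a ≠ b) :
    ∃ α : ℝ → Y, Continuous α ∧ InjOn α (Icc 0 1) ∧ α 0 = a ∧ α 1 = b ∧ ∀ t, α t ∈ U := by
  have := locallyPathConnectedSpace_of_compact_of_locallyConnected Y
  have hp := (hU.isConnected_iff_isPathConnected).1 ⟨⟨a, ha⟩, hc⟩
  have hj := hp.joinedIn a ha b hb
  have h0 : hj.somePath.extend 0 = a := Path.extend_zero _
  have h1 : hj.somePath.extend 1 = b := Path.extend_one _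
  obtain ⟨α, h⟩ := exists_arc_of_path hj.somePath.continuous_extend (by rwa [h0, h1])
  rw [h0, h1] at h
  refine ⟨α, h.1, h.2.1, h.2.2.1, h.2.2.2.1, fun t => ?_⟩
  obtain ⟨s, hs, hst⟩ := h.2.2.2.2 t
  rw [← hst, Path.extend_apply _ hs]
  exact hj.somePath_mem _

theorem CircleFree.mem_of_isPreconnected [CompactSpace Y] [LocallyConnectedSpace Y]
    (hY : CircleFree Y) {α : ℝ → Y} (hα : Continuous α) (hinj : InjOn α (Icc 0 1)) {s u t : ℝ}
    (hs : 0 ≤ s) (hsu : s < u) (hut : u < t) (ht : t ≤ 1) {C : Set Y} (hC : IsPreconnected C)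
    (hsC : α s ∈ C) (htC : α t ∈ C) : α u ∈ C := by
  by_contra huC
  have hst : α s ≠ α t := fun h => (hsu.trans hut).ne
    (hinj ⟨hs, by linarith⟩ ⟨by linarith, ht⟩ h)
  have hopen : IsOpen ({α u}ᶜ : Set Y) := isOpen_compl_singleton
  have hCsub : C ⊆ ({α u}ᶜ : Set Y) := fun x hx h => huC (h ▸ hx)
  have hCV : C ⊆ connectedComponentIn {α u}ᶜ (α s) := hC.subset_connectedComponentIn hsC hCsub
  obtain ⟨β, hβ, hβi, hβ0, hβ1, hβV⟩ := exists_arc_mem_of_isOpen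
    (hopen.connectedComponentIn (x := α s)) isPreconnected_connectedComponentIn
    (hCV hsC) (hCV htC) hst
  have hβu : ∀ v, β v ≠ α u := fun v h => connectedComponentIn_subset _ _ (hβV v) h
  set K : Set ℝ := α ⁻¹' (β '' Icc 0 1)
  have hK : IsClosed K := (isCompact_Icc.image hβ).isClosed.preimage hα
  have hsK : s ∈ K := ⟨0, ⟨le_rfl, zero_le_one⟩, hβ0⟩
  have htK : t ∈ K := ⟨1, ⟨zero_le_one, le_rfl⟩, hβ1⟩
  have huK : u ∉ K := fun ⟨v, _, hv⟩ => hβu v hv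
  obtain ⟨a, ⟨p, hp, hpa⟩, hsa, hau, ha⟩ := hK.exists_greatest_le hsK hsu.le
  obtain ⟨b, ⟨q, hq, hqb⟩, hbt, hub, hb⟩ := hK.exists_least_ge htK hut.le
  have hau' : a < u := lt_of_le_of_ne hau (by rintro rfl; exact hβu _ hpa)
  have hub' : u < b := lt_of_le_of_ne hub (by rintro rfl; exact hβu _ hqb)
  have hgap : ∀ v ∈ Icc a b, v ∈ K → v = a ∨ v = b := by
    intro v hv hvK
    rcases le_total v u with h | h
    · exact Or.inl (le_antisymm (ha v hvK h) hv.1)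
    · exact Or.inr (le_antisymm hv.2 (hb v hvK h))
  have hpq : p ≠ q := by
    rintro rfl
    have := hinj (⟨by linarith, by linarith⟩ : a ∈ Icc (0:ℝ) 1) (⟨by linarith, by linarith⟩ : b ∈ Icc (0:ℝ) 1) (hpa.symm.trans hqb)
    linarith
  have hIab : ∀ v ∈ Icc a b, v ∈ Icc (0 : ℝ) 1 := fun v hv =>
    ⟨by linarith [hv.1], by linarith [hv.2]⟩
  have hm1 : ∀ x, 0 ≤ x → x ≤ 1 → a + x * (b - a) ∈ Icc a b := fun x h0 h1 =>
    ⟨by nlinarith, by nlinarith⟩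
  have hm2 : ∀ x, 1 ≤ x → x ≤ 2 → q + (x - 1) * (p - q) ∈ Icc (0 : ℝ) 1 := fun x h0 h1 =>
    ⟨by nlinarith [mul_nonneg (sub_nonneg.2 h0) hp.1, mul_nonneg (sub_nonneg.2 h1) hq.1],
      by nlinarith [mul_nonneg (sub_nonneg.2 h0) (sub_nonneg.2 hp.2), mul_nonneg (sub_nonneg.2 h1) (sub_nonneg.2 hq.2)]⟩
  have hba : b - a ≠ 0 := by linarith
  have hpq' : p - q ≠ 0 := sub_ne_zero.2 hpq
  set l : ℝ → Y := fun x => if x ≤ 1 then α (a + x * (b - a)) else β (q + (x - 1) * (p - q))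
  have hl : Continuous l := by
    refine Continuous.if_le (by fun_prop) (by fun_prop) continuous_id continuous_const ?_
    rintro x rfl
    simp [hqb]
  have hmix : ∀ x, 0 ≤ x → x ≤ 1 → ∀ y, 1 < y → y < 2 →
      α (a + x * (b - a)) ≠ β (q + (y - 1) * (p - q)) := by
    intro x hx0 hx1 y hy1 hy2 h
    have hy := hm2 y hy1.le hy2.le
    rcases hgap _ (hm1 x hx0 hx1) ⟨_, hy, h.symm⟩ with h' | h'
    · rw [h', ← hpa] at h
      have := hβi hp hy h
      have h3 : (2 - y) * (p - q) = 0 := by linarith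
      rcases mul_eq_zero.1 h3 with h4 | h4
      · linarith
      · exact hpq' h4
    · rw [h', ← hqb] at h
      have := hβi hq hy h
      have h3 : (y - 1) * (p - q) = 0 := by linarith
      rcases mul_eq_zero.1 h3 with h4 | h4
      · linarith
      · exact hpq' h4
  have hl02 : l 0 = l 2 := by
    have h1 : ¬ (2 : ℝ) ≤ 1 := by norm_num
    have h2 : q + (2 - 1) * (p - q) = p := by ring
    simp [l, h1, h2, hpa]
  refine hY.not_injOn_loop hl.continuousOn hl02 ?_
  intro x hx y hy hxy
  by_cases hx1 : x ≤ 1 <;> by_cases hy1 : y ≤ 1 <;> simp only [l, hx1, hy1, if_true, if_false] at hxy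
  · have := hinj (hIab _ (hm1 x hx.1 hx1)) (hIab _ (hm1 y hy.1 hy1)) hxy
    exact mul_right_cancel₀ hba (add_left_cancel this)
  · exact (hmix x hx.1 hx1 y (not_le.1 hy1) hy.2 hxy).elim
  · exact (hmix y hy.1 hy1 x (not_le.1 hx1) hx.2 hxy.symm).elim
  · have := hβi (hm2 x (not_le.1 hx1).le hx.2.le) (hm2 y (not_le.1 hy1).le hy.2.le) hxy
    have := mul_right_cancel₀ hpq' (add_left_cancel this)
    linarith

end Separation

section LocallyConnectedSubsets

variable {Z : Type*} [TopologicalSpace Z] {D : Set Z}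

theorem exists_isPreconnected_mem_nhdsWithin [LocallyConnectedSpace D] {y : Z} (hy : y ∈ D)
    {O : Set Z} (hO : O ∈ 𝓝 y) :
    ∃ V, V ⊆ D ∩ O ∧ IsPreconnected V ∧ y ∈ V ∧ V ∈ 𝓝[D] y := by
  obtain ⟨V, hV, h1, h2, h3⟩ := locallyConnectedSpace_iff_subsets_isOpen_isConnected.1
    (inferInstanceAs (LocallyConnectedSpace D)) ⟨y, hy⟩ (Subtype.val ⁻¹' O)
    (continuous_subtype_val.continuousAt.preimage_mem_nhds hO)
  refine ⟨Subtype.val '' V, ?_, ?_, ⟨⟨y, hy⟩, h2, rfl⟩, ?_⟩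
  · rintro _ ⟨v, hv, rfl⟩
    exact ⟨v.2, hV hv⟩
  · exact h3.isPreconnected.image _ continuous_subtype_val.continuousOn
  · exact mem_nhds_subtype_iff_nhdsWithin.1 (h1.mem_nhds h2)

theorem connectedComponentIn_diff_mem_nhdsWithin [LocallyConnectedSpace D] {y : Z} (hy : y ∈ D)
    {K : Set Z} (hK : IsClosed K) (hyK : y ∉ K) : connectedComponentIn (D \ K) y ∈ 𝓝[D] y := by
  obtain ⟨V, hV, hc, hyV, hn⟩ := exists_isPreconnected_mem_nhdsWithin hy
    (hK.isOpen_compl.mem_nhds hyK)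
  exact mem_of_superset hn (hc.subset_connectedComponentIn hyV fun v hv => hV hv)

theorem locallyConnectedSpace_of_nhds (h : ∀ x : Z, ∃ D ∈ 𝓝 x, LocallyConnectedSpace D) :
    LocallyConnectedSpace Z := by
  rw [locallyConnectedSpace_iff_connected_subsets]
  intro x U hU
  obtain ⟨D, hD, hlc⟩ := h x
  obtain ⟨V, hV, hc, -, hn⟩ := exists_isPreconnected_mem_nhdsWithin (mem_of_mem_nhds hD) hU
  rw [nhdsWithin_eq_nhds.2 hD] at hn
  exact ⟨V, hn, hc, fun v hv => (hV hv).2⟩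

theorem IsLocalDendrite.locallyConnectedSpace (h : IsLocalDendrite Z) :
    LocallyConnectedSpace Z :=
  locallyConnectedSpace_of_nhds fun x =>
    let ⟨D, hD, hd⟩ := h x
    ⟨D, hD, hd.2.2.1⟩

end LocallyConnectedSubsets

section Dendrites

variable {Y : Type*} [MetricSpace Y] {D : Set Y}

theorem IsDendriteSet.exists_arc (hD : IsDendriteSet D) {a b : Y} (ha : a ∈ D) (hb : b ∈ D)
    (hab : a ≠ b) :
    ∃ α : ℝ → Y, Continuous α ∧ InjOn α (Icc 0 1) ∧ α 0 = a ∧ α 1 = b ∧ ∀ t, α t ∈ D := by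
  obtain ⟨h1, h2, h3, -⟩ := hD
  have := isCompact_iff_compactSpace.1 h1
  have := isPreconnected_iff_preconnectedSpace.1 h2.isPreconnected
  obtain ⟨α, hα, hi, h0, h1, -⟩ := exists_arc_mem_of_isOpen (Y := D) isOpen_univ
    isPreconnected_univ (mem_univ ⟨a, ha⟩) (mem_univ ⟨b, hb⟩) (fun h => hab (congrArg Subtype.val h))
  refine ⟨fun t => α t, continuous_subtype_val.comp hα, fun x hx y hy h => hi hx hy (Subtype.ext h),
    by simp [h0], by simp [h1], fun t => (α t).2⟩

theorem IsDendriteSet.mem_of_isPreconnected (hD : IsDendriteSet D)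
    {α : ℝ → Y} (hα : Continuous α) (hinj : InjOn α (Icc 0 1)) (hαD : ∀ t, α t ∈ D) {s u t : ℝ}
    (hs : 0 ≤ s) (hsu : s ≤ u) (hut : u ≤ t) (ht : t ≤ 1) {C : Set Y} (hC : IsPreconnected C)
    (hCD : C ⊆ D) (hsC : α s ∈ C) (htC : α t ∈ C) : α u ∈ C := by
  rcases hsu.eq_or_lt with rfl | hsu
  · exact hsC
  rcases hut.eq_or_lt with rfl | hut
  · exact htC
  obtain ⟨h1, h2, h3, h4⟩ := hD
  have := isCompact_iff_compactSpace.1 h1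
  have hC' : IsPreconnected ((Subtype.val : D → Y) ⁻¹' C) := by
    rw [← IsInducing.subtypeVal.isPreconnected_image, Subtype.image_preimage_coe,
      inter_eq_self_of_subset_right hCD]
    exact hC
  exact CircleFree.mem_of_isPreconnected (Y := D) h4 (α := fun t => ⟨α t, hαD t⟩)
    (hα.subtype_mk _) (fun x hx y hy h => hinj hx hy (congrArg Subtype.val h)) hs hsu hut ht hC'
    hsC htC

end Dendrites

section NonWandering

variable {Y : Type*} [TopologicalSpace Y] {f : Y → Y}

/-- Every nonempty open set returns to itself. -/
def NonWandering (f : Y → Y) : Prop :=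
  ∀ U : Set Y, IsOpen U → U.Nonempty → ∃ n, 1 ≤ n ∧ ∃ x ∈ U, f^[n] x ∈ U

theorem nonWandering_of_forall_not_isWanderingPoint (h : ∀ p, ¬ IsWanderingPoint f p) :
    NonWandering f := by
  intro U hU ⟨p, hp⟩
  by_contra! hne
  refine h p ⟨U, hU, hp, fun n hn => ?_⟩
  rw [eq_empty_iff_forall_notMem]
  rintro _ ⟨⟨x, hx, rfl⟩, hx'⟩
  exact hne n hn x hx hx'

theorem IsHomeomorph.iterate (hf : IsHomeomorph f) (n : ℕ) : IsHomeomorph f^[n] := by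
  induction n with
  | zero => exact (Homeomorph.refl Y).isHomeomorph
  | succ n ih => exact ih.comp hf

theorem NonWandering.exists_returns (h : NonWandering f) (hf : Continuous f) {W : Set Y}
    (hW : IsOpen W) (hne : W.Nonempty) (k : ℕ) :
    ∃ W' : Set Y, IsOpen W' ∧ W'.Nonempty ∧ W' ⊆ W ∧ ∃ N : ℕ → ℕ, StrictMono N ∧
      ∀ j ≤ k, ∀ x ∈ W', f^[N j] x ∈ W := by
  induction k with
  | zero =>
    refine ⟨W, hW, hne, Subset.rfl, id, strictMono_id, fun j hj x hx => ?_⟩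
    rw [Nat.le_zero.1 hj]
    exact hx
  | succ k ih =>
    obtain ⟨W', hW', hne', hsub, N, hN, hNW⟩ := ih
    obtain ⟨n, hn, x, hx, hxn⟩ := h W' hW' hne'
    refine ⟨W' ∩ f^[n] ⁻¹' W', hW'.inter (hW'.preimage (hf.iterate n)), ⟨x, hx, hxn⟩,
      inter_subset_left.trans hsub, fun j => Nat.casesOn j 0 (fun i => n + N i), ?_, ?_⟩
    · refine strictMono_nat_of_lt_succ fun j => ?_
      cases j with
      | zero =>
        change 0 < n + N 0
        omega
      | succ i => exact Nat.add_lt_add_left (hN (Nat.lt_succ_self i)) n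
    · intro j hj y hy
      cases j with
      | zero => exact hsub hy.1
      | succ i =>
        change f^[n + N i] y ∈ W
        rw [Nat.add_comm, Function.iterate_add_apply]
        exact hNW i (by omega) _ hy.2

theorem NonWandering.exists_mul (h : NonWandering f) (hf : Continuous f) {W : Set Y}
    (hW : IsOpen W) (hne : W.Nonempty) {m : ℕ} (hm : 1 ≤ m) :
    ∃ t, 1 ≤ t ∧ ∃ x ∈ W, f^[m * t] x ∈ W := by
  obtain ⟨W', hW', ⟨x, hx⟩, hsub, N, hN, hNW⟩ := h.exists_returns hf hW hne m
  obtain ⟨i, hi, j, hj, hij, heq⟩ := Finset.exists_ne_map_eq_of_card_lt_of_maps_to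
    (s := Finset.range (m + 1)) (t := Finset.range m) (by simp) (f := fun i => N i % m)
    (fun i _ => by simpa using Nat.mod_lt _ hm)
  wlog hlt : i < j generalizing i j
  · exact this j hj i hi hij.symm heq.symm (lt_of_le_of_ne (not_lt.1 hlt) hij.symm)
  rw [Finset.mem_range] at hi hj
  have hNlt := hN hlt
  obtain ⟨t, ht⟩ := (Nat.modEq_iff_dvd' hNlt.le).1 heq
  refine ⟨t, ?_, f^[N i] x, hNW i (by omega) x hx, ?_⟩
  · rcases Nat.eq_zero_or_pos t with rfl | h
    · omega
    · exact h
  · rw [← ht, ← Function.iterate_add_apply, Nat.sub_add_cancel hNlt.le]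
    exact hNW j (by omega) x hx

theorem NonWandering.subset_closure_image (h : NonWandering f) (hf : Continuous f) {U : Set Y}
    (hU : IsOpen U) {m : ℕ} (hm : 1 ≤ m) (hmU : MapsTo f^[m] U U) : U ⊆ closure (f^[m] '' U) := by
  by_contra hnot
  obtain ⟨x, hx, hxn⟩ := not_subset.1 hnot
  obtain ⟨t, ht, y, hy, hyt⟩ := h.exists_mul hf (hU.sdiff isClosed_closure) ⟨x, hx, hxn⟩ hm
  refine hyt.2 (subset_closure ?_)
  obtain ⟨s, rfl⟩ := Nat.exists_eq_add_of_le' ht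
  rw [Function.iterate_mul, Function.iterate_succ_apply']
  exact mem_image_of_mem _ (hmU.iterate s hy.1)

end NonWandering

section CutPoints

variable {Y : Type*} [TopologicalSpace Y] {f : Y → Y}

theorem mem_closure_of_insert_isClosed [ConnectedSpace Y] {V : Set Y} {c : Y} (hV : IsOpen V) (hne : V.Nonempty)
    (hcl : IsClosed (insert c V)) (hc : c ∉ V) : c ∈ closure V := by
  by_contra hnot
  have : closure V ⊆ V := fun x hx => by
    rcases closure_minimal (subset_insert c V) hcl hx with rfl | h
    · exact (hnot hx).elim
    · exact h
  have hclo : IsClopen V := ⟨isClosed_of_closure_subset this, hV⟩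
  rw [isClopen_iff] at hclo
  rcases hclo with h | h
  · exact hne.ne_empty h
  · exact hc (h ▸ mem_univ c)

theorem NonWandering.not_mapsTo_side [ConnectedSpace Y] (h : NonWandering f) (hf : IsHomeomorph f) {c : Y}
    (hper : ∀ m, 1 ≤ m → f^[m] c ≠ c) {V : Set Y} (hV : IsOpen V) (hne : V.Nonempty)
    (hcl : IsClosed (insert c V)) (hc : c ∉ V) {m : ℕ} (hm : 1 ≤ m) : ¬ MapsTo f^[m] V V := by
  intro hmV
  have hh := hf.iterate m
  have h1 := h.subset_closure_image hf.continuous hV hm hmV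
  have hcV := mem_closure_of_insert_isClosed hV hne hcl hc
  have hcV' : f^[m] c ∈ closure (f^[m] '' V) :=
    image_closure_subset_closure_image hh.continuous (mem_image_of_mem _ hcV)
  have h2 : closure (f^[m] '' V) ⊆ insert (f^[m] c) (f^[m] '' V) := by
    refine closure_minimal (subset_insert _ _) ?_
    rw [← image_insert_eq]
    exact hh.isClosedMap _ hcl
  have hcn : f^[m] c ∉ f^[m] '' V := by
    rintro ⟨x, hx, hxc⟩
    exact hc (hh.injective hxc ▸ hx)
  by_cases hmem : f^[m] c ∈ V
  · have hsub : closure (f^[m] '' V) ⊆ V := fun x hx => by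
      rcases h2 hx with rfl | ⟨y, hy, rfl⟩
      · exact hmem
      · exact hmV hy
    have : closure (f^[m] '' V) = V := hsub.antisymm h1
    have hclosed : IsClosed V := this ▸ isClosed_closure
    exact hc (hclosed.closure_eq ▸ hcV)
  · have h3 : V ⊆ f^[m] '' V := fun x hx => by
      rcases h2 (h1 hx) with rfl | h'
      · exact (hmem hx).elim
      · exact h'
    have h4 := closure_minimal ((image_subset_iff.2 hmV).trans (subset_insert c V)) hcl hcV'
    rcases h4 with h' | h'
    · exact hper m hm h'
    · exact hmem h'

theorem isPreconnected_subset_or {A B C : Set Y} {c : Y} (hA : IsOpen A) (hB : IsOpen B)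
    (hAB : Disjoint A B) (hcov : ∀ x, x = c ∨ x ∈ A ∨ x ∈ B) (hC : IsPreconnected C) (hc : c ∉ C) :
    C ⊆ A ∨ C ⊆ B := by
  refine isPreconnected_iff_subset_of_disjoint.1 hC A B hA hB ?_ ?_
  · intro x hx
    rcases hcov x with rfl | h
    · exact (hc hx).elim
    · exact h
  · rw [hAB.inter_eq, inter_empty]

theorem NonWandering.exists_period_of_two_sides [ConnectedSpace Y] (h : NonWandering f) (hf : IsHomeomorph f) {c : Y}
    {A B : Set Y} (hA : IsOpen A) (hB : IsOpen B) (hAB : Disjoint A B) (hcA : c ∉ A) (hcB : c ∉ B)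
    (hcov : ∀ x, x = c ∨ x ∈ A ∨ x ∈ B) (hAne : A.Nonempty) (hBne : B.Nonempty)
    (hBc : IsPreconnected B) (hEc : IsPreconnected (insert c A)) :
    ∃ m, 1 ≤ m ∧ f^[m] c = c := by
  by_contra! hper
  have hnotA : ∀ x, x ∈ insert c B → x ∉ A := by
    rintro x (rfl | hx) hxA
    · exact hcA hxA
    · exact disjoint_left.1 hAB hxA hx
  have hnotB : ∀ x, x ∈ insert c A → x ∉ B := by
    rintro x (rfl | hx) hxB
    · exact hcB hxB
    · exact disjoint_left.1 hAB hx hxB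
  have hclA : IsClosed (insert c A) := by
    have : insert c A = Bᶜ := by
      ext x
      refine ⟨fun hx => hnotB x hx, fun hx => ?_⟩
      rcases hcov x with h | h | h
      exacts [Or.inl h, Or.inr h, (hx h).elim]
    rw [this]; exact hB.isClosed_compl
  have hclB : IsClosed (insert c B) := by
    have : insert c B = Aᶜ := by
      ext x
      refine ⟨fun hx => hnotA x hx, fun hx => ?_⟩
      rcases hcov x with h | h | h
      exacts [Or.inl h, (hx h).elim, Or.inr h]
    rw [this]; exact hA.isClosed_compl
  have hcclB := mem_closure_of_insert_isClosed hB hBne hclB hcB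
  have hKc : IsPreconnected (insert c B) :=
    hBc.subset_closure (subset_insert c B) (insert_subset hcclB subset_closure)
  have hLA : ∀ m, 1 ≤ m → ¬ MapsTo f^[m] A A := fun m hm =>
    h.not_mapsTo_side hf hper hA hAne hclA hcA hm
  have hLB : ∀ m, 1 ≤ m → ¬ MapsTo f^[m] B B := fun m hm =>
    h.not_mapsTo_side hf hper hB hBne hclB hcB hm
  have himA : ∀ m, IsOpen (f^[m] '' A) := fun m => (hf.iterate m).isOpenMap _ hA
  have himB : ∀ m, IsOpen (f^[m] '' B) := fun m => (hf.iterate m).isOpenMap _ hB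
  have himd : ∀ m, Disjoint (f^[m] '' A) (f^[m] '' B) := fun m =>
    (disjoint_image_iff (hf.iterate m).injective).2 hAB
  have himcov : ∀ m x, x = f^[m] c ∨ x ∈ f^[m] '' A ∨ x ∈ f^[m] '' B := by
    intro m x
    obtain ⟨y, rfl⟩ := (hf.iterate m).surjective x
    rcases hcov y with rfl | h | h
    exacts [Or.inl rfl, Or.inr (Or.inl (mem_image_of_mem _ h)), Or.inr (Or.inr (mem_image_of_mem _ h))]
  have hsplit : ∀ C, IsPreconnected C → c ∉ C → C ⊆ A ∨ C ⊆ B := fun C hC =>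
    isPreconnected_subset_or hA hB hAB hcov hC
  have hsplit' : ∀ m C, IsPreconnected C → f^[m] c ∉ C → C ⊆ f^[m] '' A ∨ C ⊆ f^[m] '' B :=
    fun m C hC => isPreconnected_subset_or (himA m) (himB m) (himd m) (himcov m) hC
  have hmemim : ∀ m x C, f^[m] x ∈ f^[m] '' C ↔ x ∈ C := fun m x C =>
    (hf.iterate m).injective.mem_set_image
  obtain ⟨m, hm, x, hx, hxm⟩ := h B hB hBne
  have hE : insert c A ⊆ f^[m] '' B := by
    have h1 : c ∈ f^[m] '' B := by
      by_contra hnot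
      rcases hsplit _ (hBc.image _ (hf.iterate m).continuous.continuousOn) hnot with h' | h'
      · exact disjoint_left.1 hAB (h' (mem_image_of_mem _ hx)) hxm
      · exact hLB m hm (image_subset_iff.1 h')
    have h2 : f^[m] c ∈ B := by
      by_contra hnot
      rcases hsplit' m _ hBc hnot with h' | h'
      · exact disjoint_left.1 (himd m) (h' hxm) (mem_image_of_mem _ hx)
      · refine hLA m hm fun y hy => ?_
        rcases hcov (f^[m] y) with h'' | h'' | h''
        · exact (disjoint_left.1 (himd m) (mem_image_of_mem _ hy) (h''.symm ▸ h1)).elim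
        · exact h''
        · exact (disjoint_left.1 (himd m) (mem_image_of_mem _ hy) (h' h'')).elim
    rcases hsplit' m _ hEc (fun h' => hnotB _ h' h2) with h' | h'
    · exact (disjoint_left.1 (himd m) (h' (mem_insert _ _)) h1).elim
    · exact h'
  obtain ⟨t, ht, z, hz, hzt⟩ := h A hA hAne
  have hK : insert c B ⊆ f^[t] '' A := by
    have h1 : c ∈ f^[t] '' insert c A := by
      by_contra hnot
      rcases hsplit _ (hEc.image _ (hf.iterate t).continuous.continuousOn) hnot with h' | h'
      · exact hLA t ht (image_subset_iff.1 ((image_mono (subset_insert c A)).trans h'))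
      · exact disjoint_left.1 hAB hzt (h' (mem_image_of_mem _ (Or.inr hz)))
    have h2 : f^[t] c ∈ insert c A := by
      by_contra hnot
      rcases hsplit' t _ hEc hnot with h' | h'
      · refine hLB t ht fun y hy => ?_
        rcases hcov (f^[t] y) with h'' | h'' | h''
        · exact (disjoint_left.1 (himd t) (h' (Or.inl h'')) (mem_image_of_mem _ hy)).elim
        · exact (disjoint_left.1 (himd t) (h' (Or.inr h'')) (mem_image_of_mem _ hy)).elim
        · exact h''
      · exact disjoint_left.1 (himd t) (mem_image_of_mem _ hz) (h' (Or.inr hzt))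
    have h3 : f^[t] c ∈ A := h2.resolve_left (hper t ht)
    have h4 : c ∈ f^[t] '' A := by
      rw [image_insert_eq] at h1
      exact h1.resolve_left (fun h => hper t ht h.symm)
    rcases hsplit' t _ hKc (fun h' => hnotA _ h' h3) with h' | h'
    · exact h'
    · exact (disjoint_left.1 (himd t) h4 (h' (mem_insert _ _))).elim
  have hB1 : ∀ y ∈ insert c B, f^[t] y ∈ f^[m] '' B := by
    intro y hy
    apply hE
    rcases hcov (f^[t] y) with h' | h' | h'
    · exact Or.inl h'
    · exact Or.inr h'
    · obtain ⟨w, hw, hwy⟩ := hK (Or.inr h')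
      exact (hnotA y hy ((hf.iterate t).injective hwy ▸ hw)).elim
  rcases lt_trichotomy m t with hlt | rfl | hlt
  · refine hLB (t - m) (by omega) fun y hy => ?_
    rw [← hmemim m, ← Function.iterate_add_apply, Nat.add_sub_cancel' hlt.le]
    exact hB1 y (Or.inr hy)
  · exact hcB ((hmemim m c B).1 (hB1 c (mem_insert _ _)))
  · have key : ∀ y ∈ insert c B, y ∈ f^[m - t] '' B := by
      intro y hy
      obtain ⟨w, hw, hwy⟩ := hB1 y hy
      refine ⟨w, hw, (hf.iterate t).injective ?_⟩
      rw [← Function.iterate_add_apply, Nat.add_sub_cancel' hlt.le, hwy]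
    refine hLA (m - t) (by omega) fun y hy => ?_
    rcases hcov (f^[m - t] y) with h' | h' | h'
    · exact (disjoint_left.1 hAB hy ((hmemim _ _ _).1 (key _ (Or.inl h')))).elim
    · exact h'
    · exact (disjoint_left.1 hAB hy ((hmemim _ _ _).1 (key _ (Or.inr h')))).elim

theorem isClosed_insert_connectedComponentIn [T1Space Y] (c x : Y) :
    IsClosed (insert c (connectedComponentIn {c}ᶜ x)) := by
  by_cases hx : x ∈ ({c}ᶜ : Set Y)
  swap
  · rw [connectedComponentIn_eq_empty hx]
    simp
  refine isClosed_of_closure_subset fun y hy => ?_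
  by_cases hyc : y = c
  · exact Or.inl hyc
  right
  rw [insert_eq, closure_union, closure_singleton] at hy
  have hy' := hy.resolve_left hyc
  have := isPreconnected_connectedComponentIn (x := x) (F := ({c}ᶜ : Set Y)).subset_closure
    (subset_insert y _) (insert_subset hy' subset_closure)
  refine this.subset_connectedComponentIn (Or.inr (mem_connectedComponentIn hx)) ?_
    (mem_insert _ _)
  exact insert_subset hyc (connectedComponentIn_subset _ _)

theorem isPreconnected_insert_connectedComponentIn [T1Space Y] [ConnectedSpace Y]
    [LocallyConnectedSpace Y] {c x : Y}
    (hx : x ≠ c) : IsPreconnected (insert c (connectedComponentIn {c}ᶜ x)) := by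
  have hc : c ∉ connectedComponentIn {c}ᶜ x := fun h => connectedComponentIn_subset _ _ h rfl
  exact isPreconnected_connectedComponentIn.subset_closure (subset_insert _ _)
    (insert_subset (mem_closure_of_insert_isClosed (isOpen_compl_singleton.connectedComponentIn)
      ⟨x, mem_connectedComponentIn hx⟩ (isClosed_insert_connectedComponentIn c x) hc)
      subset_closure)

theorem NonWandering.exists_period_of_cut [T1Space Y] [ConnectedSpace Y]
    [LocallyConnectedSpace Y] (h : NonWandering f)
    (hf : IsHomeomorph f) {c : Y} {B₀ : Set Y} (hB : IsOpen B₀) (hne : (B₀ \ {c}).Nonempty)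
    (hcl : IsClosed (insert c B₀)) (hcompl : (insert c B₀)ᶜ.Nonempty) :
    ∃ m, 1 ≤ m ∧ f^[m] c = c := by
  obtain ⟨x, hx, hxc⟩ := hne
  have hxc : x ≠ c := hxc
  set B := connectedComponentIn {c}ᶜ x
  have hcB : c ∉ B := fun h => connectedComponentIn_subset _ _ h rfl
  have hBo : IsOpen B := isOpen_compl_singleton.connectedComponentIn
  have hxB : x ∈ B := mem_connectedComponentIn hxc
  have hBB : B ⊆ B₀ := by
    refine IsPreconnected.subset_left_of_subset_union hB hcl.isOpen_compl
      (disjoint_compl_right.mono_left (subset_insert _ _)) ?_ ⟨x, hxB, hx⟩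
      isPreconnected_connectedComponentIn
    intro y hy
    by_cases hyB : y ∈ B₀
    · exact Or.inl hyB
    · right
      rintro (rfl | h')
      exacts [hcB hy, hyB h']
  refine h.exists_period_of_two_sides hf (A := (insert c B)ᶜ) (B := B)
    (isClosed_insert_connectedComponentIn c x).isOpen_compl hBo
    (disjoint_compl_left.mono_right (subset_insert _ _)) (fun h => h (mem_insert _ _)) hcB ?_
    (hcompl.mono (compl_subset_compl.2 (insert_subset_insert hBB))) ⟨x, hxB⟩
    isPreconnected_connectedComponentIn ?_
  · intro y
    by_cases hy : y = c
    · exact Or.inl hy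
    by_cases hyB : y ∈ B
    · exact Or.inr (Or.inr hyB)
    · exact Or.inr (Or.inl (by rintro (h' | h') <;> contradiction))
  · refine isPreconnected_of_forall c fun y hy => ?_
    rcases hy with rfl | hy
    · exact ⟨{y}, by simp, rfl, rfl, isPreconnected_singleton⟩
    have hyc : y ≠ c := fun h => hy (Or.inl h)
    refine ⟨_, ?_, mem_insert _ _, Or.inr (mem_connectedComponentIn hyc),
      isPreconnected_insert_connectedComponentIn hyc⟩
    refine insert_subset_insert fun z hz => ?_
    rintro (rfl | hzB)
    · exact connectedComponentIn_subset _ _ hz rfl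
    · refine hy (Or.inr ?_)
      have : connectedComponentIn {c}ᶜ x = connectedComponentIn {c}ᶜ y :=
        (connectedComponentIn_eq hzB).trans (connectedComponentIn_eq hz).symm
      change y ∈ connectedComponentIn {c}ᶜ x
      rw [this]
      exact mem_connectedComponentIn hyc

end CutPoints

section Collapsing

variable {Y : Type*} [MetricSpace Y] {f : Y → Y} {l : Filter ℕ} {n : ℕ → ℕ} {Z Z' : Set Y}

/-- The preimages of `Z` under `f^[n k]` have diameters tending to `0` along `l`. -/
def Collapses (f : Y → Y) (l : Filter ℕ) (n : ℕ → ℕ) (Z : Set Y) : Prop :=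
  ∀ ε > 0, ∀ᶠ k in l, ∀ x y, f^[n k] x ∈ Z → f^[n k] y ∈ Z → dist x y < ε

theorem Collapses.mono (h : Collapses f l n Z) (hZ : Z' ⊆ Z) : Collapses f l n Z' :=
  fun ε hε => (h ε hε).mono fun _ hk x y hx hy => hk x y (hZ hx) (hZ hy)

theorem Collapses.image [CompactSpace Y] (hf : IsHomeomorph f) (h : Collapses f l n Z) :
    Collapses f l n (f '' Z) := by
  intro ε hε
  obtain ⟨δ, hδ, hfu⟩ := Metric.uniformContinuous_iff.1
    (CompactSpace.uniformContinuous_of_continuous hf.continuous) ε hε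
  refine (h δ hδ).mono fun k hk x y hx hy => ?_
  obtain ⟨x, rfl⟩ := hf.surjective x
  obtain ⟨y, rfl⟩ := hf.surjective y
  rw [← Function.iterate_succ_apply, Function.iterate_succ_apply',
    hf.injective.mem_set_image] at hx hy
  exact hfu (hk x y hx hy)

theorem Collapses.image_iterate [CompactSpace Y] (hf : IsHomeomorph f) (h : Collapses f l n Z)
    (j : ℕ) : Collapses f l n (f^[j] '' Z) := by
  induction j with
  | zero => simpa using h
  | succ j ih =>
    rw [Function.iterate_succ', image_comp]
    exact ih.image hf

theorem Collapses.union (hf : IsHomeomorph f) (h : Collapses f l n Z) (h' : Collapses f l n Z')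
    (hne : (Z ∩ Z').Nonempty) : Collapses f l n (Z ∪ Z') := by
  obtain ⟨z, hz, hz'⟩ := hne
  intro ε hε
  filter_upwards [h (ε / 2) (half_pos hε), h' (ε / 2) (half_pos hε)] with k hk hk' x y hx hy
  obtain ⟨w, rfl⟩ := (hf.iterate (n k)).surjective z
  have key : ∀ x, f^[n k] x ∈ Z ∪ Z' → dist x w < ε / 2 := fun x hx =>
    hx.elim (fun hx => hk x w hx hz) (fun hx => hk' x w hx hz')
  linarith [key x hx, key y hy, dist_triangle_right x y w]

theorem Collapses.ne_univ [Nontrivial Y] [l.NeBot] (h : Collapses f l n Z) : Z ≠ univ := by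
  rintro rfl
  obtain ⟨x, y, hxy⟩ := exists_pair_ne Y
  obtain ⟨k, hk⟩ := (h (dist x y) (dist_pos.2 hxy)).exists
  exact lt_irrefl _ (hk x y (mem_univ _) (mem_univ _))

theorem Collapses.eq_of_periodic [l.NeBot] (hf : IsHomeomorph f) (h : Collapses f l n Z)
    {p q : Y} (hp : p ∈ Z) (hq : q ∈ Z) {T : ℕ} (hT : 1 ≤ T) (hpT : f^[T] p = p)
    (hqT : f^[T] q = q) : p = q := by
  by_contra hpq
  obtain ⟨s, -, hs⟩ := Finset.exists_min_image (Finset.range T)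
    (fun s => dist (f^[s] p) (f^[s] q)) ⟨0, Finset.mem_range.2 hT⟩
  have hpos : 0 < dist (f^[s] p) (f^[s] q) :=
    dist_pos.2 fun h => hpq ((hf.iterate s).injective h)
  obtain ⟨k, hk⟩ := (h _ hpos).exists
  have hback : ∀ p, f^[T] p = p → f^[n k] (f^[T * n k - n k] p) = p := by
    intro p hp
    rw [← Function.iterate_add_apply, Nat.add_sub_cancel' (Nat.le_mul_of_pos_left _ hT),
      Function.iterate_mul]
    exact Function.iterate_fixed hp _
  have h1 := hk _ _ ((hback p hpT).symm ▸ hp) ((hback q hqT).symm ▸ hq)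
  have h2 := hs ((T * n k - n k) % T) (Finset.mem_range.2 (Nat.mod_lt _ hT))
  rw [Function.IsPeriodicPt.iterate_mod_apply hpT, Function.IsPeriodicPt.iterate_mod_apply hqT] at h2
  linarith

end Collapsing

section CollapsingArc

variable {Y : Type*} [MetricSpace Y] {D : Set Y}

/-- `α` parametrizes an arc in `D`. -/
structure IsArcIn (D : Set Y) (α : ℝ → Y) : Prop where
  continuous : Continuous α
  injOn : InjOn α (Icc 0 1)
  mem : ∀ t, α t ∈ D

theorem IsDendriteSet.exists_arc_mem_ball (hD : IsDendriteSet D) {x y : Y} {r : ℝ} (hr : 0 < r)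
    (hx : x ∈ D) (hy : y ∈ D) (hxy : x ≠ y) :
    ∃ α : ℝ → Y, IsArcIn D α ∧ α 0 = x ∧ α 1 = y ∧ ∃ p q : ℝ, 0 < p ∧ p < q ∧ q < 1 ∧
      ∀ t ∈ Icc p q, α t ∈ Metric.ball x r := by
  obtain ⟨α, hα, hi, h0, h1, hm⟩ := hD.exists_arc hx hy hxy
  obtain ⟨δ, hδ, h⟩ := Metric.continuousAt_iff.1 hα.continuousAt r hr
  refine ⟨α, ⟨hα, hi, hm⟩, h0, h1, min (δ / 2) (1 / 2) / 2, min (δ / 2) (1 / 2), ?_, ?_, ?_, ?_⟩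
  · positivity
  · exact half_lt_self (by positivity)
  · exact (min_le_right _ _).trans_lt (by norm_num)
  · intro t ht
    rw [Metric.mem_ball, ← h0]
    have ht0 : 0 < t := lt_of_lt_of_le (by positivity) ht.1
    apply h
    rw [Real.dist_eq, sub_zero, abs_of_pos ht0]
    have := ht.2.trans (min_le_left _ _)
    linarith

theorem IsDendriteSet.exists_finite_crossing_arcs [CompactSpace Y] (hD : IsDendriteSet D) {x₀ : Y}
    {r : ℝ} (hr : 0 < r) (hball : Metric.closedBall x₀ r ⊆ interior D) :
    ∃ (F : Finset Y) (α : Y → ℝ → Y) (p q : Y → ℝ),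
      (∀ y ∈ F, IsArcIn D (α y) ∧ 0 < p y ∧ p y < q y ∧ q y < 1 ∧
        ∀ t ∈ Icc (p y) (q y), α y t ∈ interior D) ∧
      ∃ N ∈ 𝓝 x₀, ∀ P : Set Y, IsPreconnected P → (P ∩ N).Nonempty → ¬ P ⊆ Metric.ball x₀ r →
        ∃ y ∈ F, α y '' Icc (p y) (q y) ⊆ P := by
  have := hD.2.2.1
  have hintD : ∀ z ∈ Metric.closedBall x₀ r, 𝓝[D] z = 𝓝 z := fun z hz =>
    nhdsWithin_eq_nhds.2 (mem_interior_iff_mem_nhds.1 (hball hz))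
  have hx₀b : x₀ ∈ Metric.closedBall x₀ r := Metric.mem_closedBall_self hr.le
  have hx₀D : x₀ ∈ D := interior_subset (hball hx₀b)
  have hsph : ∀ y ∈ Metric.sphere x₀ r, y ∈ D := fun y hy =>
    interior_subset (hball (Metric.sphere_subset_closedBall hy))
  have hex : ∀ y : Y, ∃ (α : ℝ → Y) (p q : ℝ), y ∈ Metric.sphere x₀ r →
      IsArcIn D α ∧ α 0 = x₀ ∧ α 1 = y ∧ 0 < p ∧ p < q ∧ q < 1 ∧
      ∀ t ∈ Icc p q, α t ∈ Metric.ball x₀ r := by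
    intro y
    by_cases hy : y ∈ Metric.sphere x₀ r
    · obtain ⟨α, h1, h2, h3, p, q, h4⟩ := hD.exists_arc_mem_ball hr hx₀D (hsph y hy)
        (Metric.ne_of_mem_sphere hy hr.ne').symm
      exact ⟨α, p, q, fun _ => ⟨h1, h2, h3, h4⟩⟩
    · exact ⟨fun _ => y, 0, 0, fun h => (hy h).elim⟩
  choose α p q hα using hex
  set Ny : Y → Set Y := fun y => connectedComponentIn (D \ {α y (p y)}) x₀
  set My : Y → Set Y := fun y => connectedComponentIn (D \ {α y (q y)}) y
  have h01 : ∀ {y}, y ∈ Metric.sphere x₀ r → ∀ t ∈ Icc (p y) (q y), t ∈ Icc (0 : ℝ) 1 := by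
    intro y hy t ht
    obtain ⟨-, -, -, h4, h5, h6, -⟩ := hα y hy
    exact ⟨h4.le.trans ht.1, ht.2.trans h6.le⟩
  have hx₀ne : ∀ {y}, y ∈ Metric.sphere x₀ r → ∀ t ∈ Icc (p y) (q y), x₀ ≠ α y t := by
    intro y hy t ht h
    obtain ⟨h1, h2, h3, h4, h5, h6, h7⟩ := hα y hy
    have := h1.injOn ⟨le_rfl, zero_le_one⟩ (h01 hy t ht) (h2.trans h)
    linarith [ht.1]
  have hyne : ∀ {y}, y ∈ Metric.sphere x₀ r → ∀ t ∈ Icc (p y) (q y), y ≠ α y t := by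
    intro y hy t ht h
    obtain ⟨h1, h2, h3, h4, h5, h6, h7⟩ := hα y hy
    have := h1.injOn ⟨zero_le_one, le_rfl⟩ (h01 hy t ht) (h3.trans h)
    linarith [ht.2]
  have hMn : ∀ y ∈ Metric.sphere x₀ r, My y ∈ 𝓝 y := by
    intro y hy
    obtain ⟨-, -, -, h4, h5, h6, -⟩ := hα y hy
    rw [← hintD y (Metric.sphere_subset_closedBall hy)]
    exact connectedComponentIn_diff_mem_nhdsWithin (hsph y hy) isClosed_singleton
      (hyne hy _ ⟨h5.le, le_rfl⟩)
  have hNn : ∀ y ∈ Metric.sphere x₀ r, Ny y ∈ 𝓝 x₀ := by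
    intro y hy
    obtain ⟨-, -, -, h4, h5, h6, -⟩ := hα y hy
    rw [← hintD x₀ hx₀b]
    exact connectedComponentIn_diff_mem_nhdsWithin hx₀D isClosed_singleton
      (hx₀ne hy _ ⟨le_rfl, h5.le⟩)
  obtain ⟨F, hF, hcov⟩ := (isCompact_sphere x₀ r).elim_nhds_subcover My hMn
  refine ⟨F, α, p, q, fun y hy => ?_, Metric.ball x₀ r ∩ ⋂ y ∈ F, Ny y, ?_, ?_⟩
  · obtain ⟨h1, h2, h3, h4, h5, h6, h7⟩ := hα y (hF y hy)
    exact ⟨h1, h4, h5, h6, fun t ht => hball (Metric.ball_subset_closedBall (h7 t ht))⟩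
  · exact inter_mem (Metric.ball_mem_nhds _ hr)
      ((biInter_finset_mem F).2 fun y hy => hNn y (hF y hy))
  intro P hP ⟨z, hzP, hzb, hzN⟩ hPb
  by_contra! hno
  have hno' : ∀ y, ∃ u, y ∈ F → u ∈ Icc (p y) (q y) ∧ α y u ∉ P := by
    intro y
    by_cases hy : y ∈ F
    · obtain ⟨_, ⟨u, hu, rfl⟩, huP⟩ := not_subset.1 (hno y hy)
      exact ⟨u, fun _ => ⟨hu, huP⟩⟩
    · exact ⟨0, fun h => (hy h).elim⟩
  choose u hu using hno'
  set Q : Y → Set Y := fun y => connectedComponentIn (D \ {α y (u y)}) x₀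
  have hQn : ∀ y, ∀ z ∈ Q y, z ∈ Metric.closedBall x₀ r → Q y ∈ 𝓝 z := by
    intro y z hz hzb
    rw [← hintD z hzb]
    have hz' := connectedComponentIn_subset _ _ hz
    change connectedComponentIn _ _ ∈ _
    rw [connectedComponentIn_eq hz]
    exact connectedComponentIn_diff_mem_nhdsWithin hz'.1 isClosed_singleton hz'.2
  have hNQ : ∀ y ∈ F, Ny y ⊆ Q y := by
    intro y hy
    have hyS := hF y hy
    obtain ⟨h1, h2, h3, h4, h5, h6, h7⟩ := hα y hyS
    obtain ⟨hu1, hu2⟩ := hu y hy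
    have hx₀N : x₀ ∈ Ny y := mem_connectedComponentIn ⟨hx₀D, hx₀ne hyS _ ⟨le_rfl, h5.le⟩⟩
    refine isPreconnected_connectedComponentIn.subset_connectedComponentIn hx₀N fun w hw => ?_
    refine ⟨(connectedComponentIn_subset _ _ hw).1, ?_⟩
    rintro rfl
    have := hD.mem_of_isPreconnected h1.continuous h1.injOn h1.mem le_rfl h4.le hu1.1
      (hu1.2.trans h6.le) (isPreconnected_connectedComponentIn (F := D \ {α y (p y)}) (x := x₀))
      ((connectedComponentIn_subset _ _).trans sdiff_subset) (by rw [h2]; exact hx₀N) hw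
    exact (connectedComponentIn_subset _ _ this).2 rfl
  set W := Metric.ball x₀ r ∩ ⋂ y ∈ F, Q y
  have hW : IsOpen W := by
    rw [isOpen_iff_mem_nhds]
    intro z hz
    refine inter_mem (Metric.isOpen_ball.mem_nhds hz.1) ((biInter_finset_mem F).2 fun y hy => ?_)
    exact hQn y z (mem_iInter₂.1 hz.2 y hy) (Metric.ball_subset_closedBall hz.1)
  have hzW : z ∈ W := ⟨hzb, mem_iInter₂.2 fun y hy => hNQ y hy (mem_iInter₂.1 hzN y hy)⟩
  obtain ⟨z', hzP', hz', hzW'⟩ : ∃ z' ∈ P, z' ∈ closure W ∧ z' ∉ W := by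
    by_contra! hcon
    refine hPb ((hP.subset_left_of_subset_union hW isClosed_closure.isOpen_compl
      (disjoint_compl_right.mono_left subset_closure) ?_ ⟨z, hzP, hzW⟩).trans inter_subset_left)
    intro w hw
    by_cases h : w ∈ closure W
    · exact Or.inl (hcon w hw h)
    · exact Or.inr h
  have hzcb : z' ∈ Metric.closedBall x₀ r :=
    closure_minimal (inter_subset_left.trans Metric.ball_subset_closedBall)
      Metric.isClosed_closedBall hz'
  have hzQ : ∀ y ∈ F, z' ∈ closure (Q y) := fun y hy =>
    closure_mono (inter_subset_right.trans (biInter_subset_of_mem hy)) hz'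
  have hQD : ∀ y, Q y ⊆ D := fun y => (connectedComponentIn_subset _ _).trans sdiff_subset
  by_cases hzb' : z' ∈ Metric.ball x₀ r
  · obtain ⟨y, hy, hzy⟩ : ∃ y ∈ F, z' ∉ Q y := by
      by_contra! hcon
      exact hzW' ⟨hzb', mem_iInter₂.2 hcon⟩
    have hzne : z' ∉ ({α y (u y)} : Set Y) := by
      rintro rfl
      exact (hu y hy).2 hzP'
    have hz'D : z' ∈ D := interior_subset (hball hzcb)
    have hn := connectedComponentIn_diff_mem_nhdsWithin hz'D isClosed_singleton hzne
    rw [hintD z' hzcb] at hn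
    obtain ⟨w, hw1, hw2⟩ := mem_closure_iff_nhds.1 (hzQ y hy) _ hn
    refine hzy ?_
    change z' ∈ connectedComponentIn _ _
    rw [connectedComponentIn_eq hw2, ← connectedComponentIn_eq hw1]
    exact mem_connectedComponentIn ⟨hz'D, hzne⟩
  · have hzs : z' ∈ Metric.sphere x₀ r := le_antisymm hzcb (not_lt.1 hzb')
    obtain ⟨y, hy, hzy⟩ := mem_iUnion₂.1 (hcov hzs)
    have hyS := hF y hy
    obtain ⟨h1, h2, h3, h4, h5, h6, h7⟩ := hα y hyS
    obtain ⟨hu1, hu2⟩ := hu y hy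
    have hMz : My y ∈ 𝓝 z' := by
      rw [← hintD z' hzcb]
      have hz2 := connectedComponentIn_subset _ _ hzy
      change connectedComponentIn _ _ ∈ _
      rw [connectedComponentIn_eq hzy]
      exact connectedComponentIn_diff_mem_nhdsWithin hz2.1 isClosed_singleton hz2.2
    obtain ⟨w, hw1, hw2⟩ := mem_closure_iff_nhds.1 (hzQ y hy) _ hMz
    have hMD : My y ⊆ D := (connectedComponentIn_subset _ _).trans sdiff_subset
    have hyM : α y 1 ∈ My y := by
      rw [h3]
      exact mem_connectedComponentIn ⟨hsph y hyS, hyne hyS _ ⟨h5.le, le_rfl⟩⟩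
    have hx₀Q : α y 0 ∈ Q y := by
      rw [h2]
      exact mem_connectedComponentIn ⟨hx₀D, hx₀ne hyS _ hu1⟩
    have hpre : IsPreconnected (Q y ∪ My y) := IsPreconnected.union w hw2 hw1
      isPreconnected_connectedComponentIn isPreconnected_connectedComponentIn
    have hmem := hD.mem_of_isPreconnected h1.continuous h1.injOn h1.mem le_rfl
      (h4.le.trans hu1.1) (hu1.2.trans h6.le) le_rfl hpre (union_subset (hQD y) hMD)
      (Or.inl hx₀Q) (Or.inr hyM)
    rcases hmem with hm | hm
    · exact (connectedComponentIn_subset _ _ hm).2 rfl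
    · have := hD.mem_of_isPreconnected h1.continuous h1.injOn h1.mem (h4.le.trans hu1.1)
        hu1.2 h6.le le_rfl isPreconnected_connectedComponentIn hMD hm hyM
      exact (connectedComponentIn_subset _ _ this).2 rfl

end CollapsingArc

section NonEquicontinuous

variable {Y : Type*} [MetricSpace Y]

theorem exists_collapsing_arc [CompactSpace Y] (hY : IsLocalDendrite Y) {f : Y → Y}
    (hf : IsHomeomorph f) {ε : ℝ} (hε : 0 < ε)
    (hne : ∀ δ > 0, ∃ n x y, dist x y < δ ∧ ε ≤ dist (f^[n] x) (f^[n] y)) :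
    ∃ (n : ℕ → ℕ) (D : Set Y) (α : ℝ → Y) (p q : ℝ), IsDendriteSet D ∧ IsArcIn D α ∧ 0 < p ∧
      p < q ∧ q < 1 ∧ (∀ t ∈ Icc p q, α t ∈ interior D) ∧
      Collapses f (hyperfilter ℕ : Filter ℕ) n (α '' Icc p q) := by
  have := hY.locallyConnectedSpace
  have hex : ∀ k : ℕ, ∃ n x y J, ε ≤ dist (f^[n] x) (f^[n] y) ∧ IsPreconnected J ∧ x ∈ J ∧ y ∈ J ∧
      ∀ u ∈ J, ∀ v ∈ J, dist u v ≤ 1 / ((k : ℝ) + 1) := by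
    intro k
    obtain ⟨δ, hδ, hlink⟩ := exists_linkedAt_of_dist_lt (Y := Y) (Nat.one_div_pos_of_nat (n := k))
    obtain ⟨n, x, y, hxy, h⟩ := hne δ hδ
    obtain ⟨J, h1, h2, h3, h4⟩ := hlink x y hxy
    exact ⟨n, x, y, J, h, h1, h2, h3, h4⟩
  choose n x y J hd hJc hx hy hJ using hex
  obtain ⟨x₀, -, hx₀⟩ := isCompact_univ.ultrafilter_le_nhds
    (Ultrafilter.map (fun k => f^[n k] (x k)) (hyperfilter ℕ)) (by simp)
  obtain ⟨D, hDn, hD⟩ := hY x₀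
  obtain ⟨r₀, hr₀, hball⟩ := Metric.nhds_basis_closedBall.mem_iff.1 (interior_mem_nhds.2 hDn)
  set r := min r₀ (ε / 2)
  have hr : 0 < r := lt_min hr₀ (half_pos hε)
  obtain ⟨F, α, p, q, hF, N, hN, hP⟩ := hD.exists_finite_crossing_arcs hr
    ((Metric.closedBall_subset_closedBall (min_le_left _ _)).trans hball)
  have hev : ∀ᶠ k in (hyperfilter ℕ : Filter ℕ), ∃ y ∈ (F : Set Y),
      α y '' Icc (p y) (q y) ⊆ f^[n k] '' J k := by
    have hN' : ∀ᶠ k in (hyperfilter ℕ : Filter ℕ), f^[n k] (x k) ∈ N := hx₀ hN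
    filter_upwards [hN'] with k hk
    refine hP _ ((hJc k).image _ (hf.iterate _).continuous.continuousOn)
      ⟨_, mem_image_of_mem _ (hx k), hk⟩ fun hsub => ?_
    have h1 := hsub (mem_image_of_mem _ (hx k))
    have h2 := hsub (mem_image_of_mem _ (hy k))
    rw [Metric.mem_ball] at h1 h2
    have h3 := dist_triangle_right (f^[n k] (x k)) (f^[n k] (y k)) x₀
    have h4 := hd k
    have h5 : r ≤ ε / 2 := min_le_right _ _
    linarith
  obtain ⟨y, hyF, hy⟩ : ∃ y ∈ (F : Set Y), ∀ᶠ k in (hyperfilter ℕ : Filter ℕ),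
      α y '' Icc (p y) (q y) ⊆ f^[n k] '' J k :=
    (Ultrafilter.eventually_exists_mem_iff F.finite_toSet).1 hev
  obtain ⟨h1, h2, h3, h4, h5⟩ := hF y hyF
  refine ⟨n, D, α y, p y, q y, hD, h1, h2, h3, h4, h5, fun e he => ?_⟩
  have hsmall : ∀ᶠ k : ℕ in (hyperfilter ℕ : Filter ℕ), 1 / ((k : ℝ) + 1) < e :=
    (tendsto_one_div_add_atTop_nhds_zero_nat.eventually (gt_mem_nhds he)).filter_mono
      Nat.hyperfilter_le_atTop
  filter_upwards [hy, hsmall] with k hk hke u v hu hv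
  have hmem : ∀ w, f^[n k] w ∈ α y '' Icc (p y) (q y) → w ∈ J k := fun w hw =>
    (hf.iterate (n k)).injective.mem_set_image.1 (hk hw)
  exact (hJ k u (hmem u hu) v (hmem v hv)).trans_lt hke

end NonEquicontinuous

section FreeArc

variable {Y : Type*} [MetricSpace Y] {f : Y → Y} {D : Set Y} {α : ℝ → Y} {p q : ℝ}

theorem connectedComponentIn_eq_of_mem_closure [LocallyConnectedSpace D] {K : Set Y}
    (hK : IsClosed K) {x y : Y} (hy : y ∈ D \ K)
    (hcl : y ∈ closure (connectedComponentIn (D \ K) x)) :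
    y ∈ connectedComponentIn (D \ K) x := by
  obtain ⟨O, hO, hsub⟩ := mem_nhdsWithin_iff_exists_mem_nhds_inter.1
    (connectedComponentIn_diff_mem_nhdsWithin hy.1 hK hy.2)
  obtain ⟨w, hw1, hw2⟩ := mem_closure_iff_nhds.1 hcl O hO
  have hw3 := hsub ⟨hw1, (connectedComponentIn_subset _ _ hw2).1⟩
  rw [connectedComponentIn_eq hw2, ← connectedComponentIn_eq hw3]
  exact mem_connectedComponentIn hy

theorem IsDendriteSet.subsingleton_mem_closure_component (hD : IsDendriteSet D)
    (hα : IsArcIn D α) (hp : 0 ≤ p) (hq : q ≤ 1) (x : Y) :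
    {s ∈ Icc p q | α s ∈ closure (connectedComponentIn (D \ α '' Icc p q) x)}.Subsingleton := by
  intro s hs t ht
  by_contra hst
  wlog hlt : s < t generalizing s t
  · exact this ht hs (Ne.symm hst) (lt_of_le_of_ne (not_lt.1 hlt) (Ne.symm hst))
  set B := connectedComponentIn (D \ α '' Icc p q) x
  have hBD : B ⊆ D := (connectedComponentIn_subset _ _).trans sdiff_subset
  have hpre : IsPreconnected (insert (α s) (insert (α t) B)) :=
    isPreconnected_connectedComponentIn.subset_closure
      ((subset_insert _ _).trans (subset_insert _ _))
      (insert_subset hs.2 (insert_subset ht.2 subset_closure))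
  have h01 : ∀ u ∈ Icc p q, u ∈ Icc (0 : ℝ) 1 := fun u hu => ⟨hp.trans hu.1, hu.2.trans hq⟩
  have humem : (s + t) / 2 ∈ Icc p q :=
    ⟨by linarith [hs.1.1, ht.1.1], by linarith [hs.1.2, ht.1.2]⟩
  have := hD.mem_of_isPreconnected hα.continuous hα.injOn hα.mem (h01 s hs.1).1
    (show s ≤ (s + t) / 2 by linarith) (show (s + t) / 2 ≤ t by linarith) (h01 t ht.1).2 hpre
    (insert_subset (hα.mem s) (insert_subset (hα.mem t) hBD)) (Or.inl rfl) (Or.inr (Or.inl rfl))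
  rcases this with h | h | h
  · have := hα.injOn (h01 _ humem) (h01 s hs.1) h
    linarith
  · have := hα.injOn (h01 _ humem) (h01 t ht.1) h
    linarith
  · exact (connectedComponentIn_subset _ _ h).2 (mem_image_of_mem _ humem)

theorem IsDendriteSet.component_not_subset_interior [ConnectedSpace Y] [LocallyConnectedSpace Y]
    (hf : IsHomeomorph f) (hnw : NonWandering f) (hD : IsDendriteSet D) (hα : IsArcIn D α)
    (hp : 0 ≤ p) (hpq : p < q) (hq : q ≤ 1)
    (hper : ∀ t ∈ Icc p q, ∀ m, 1 ≤ m → f^[m] (α t) ≠ α t) {x : Y} (hx : x ∈ D \ α '' Icc p q) :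
    ¬ connectedComponentIn (D \ α '' Icc p q) x ⊆ interior D := by
  intro hint
  have := hD.2.2.1
  have hA : IsClosed (α '' Icc p q) := (isCompact_Icc.image hα.continuous).isClosed
  have hss := hD.subsingleton_mem_closure_component hα hp hq x
  set B := connectedComponentIn (D \ α '' Icc p q) x
  have hBs : B ⊆ D \ α '' Icc p q := connectedComponentIn_subset _ _
  have hxB : x ∈ B := mem_connectedComponentIn hx
  have hBo : IsOpen B := by
    rw [isOpen_iff_mem_nhds]
    intro z hz
    have hz' := hBs hz
    rw [← nhdsWithin_eq_nhds.2 (mem_interior_iff_mem_nhds.1 (hint hz))]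
    change connectedComponentIn _ _ ∈ _
    rw [connectedComponentIn_eq hz]
    exact connectedComponentIn_diff_mem_nhdsWithin hz'.1 hA hz'.2
  have hcl : ∀ z ∈ closure B, z ∈ B ∨ z ∈ α '' Icc p q := by
    intro z hz
    by_cases hzA : z ∈ α '' Icc p q
    · exact Or.inr hzA
    · exact Or.inl (connectedComponentIn_eq_of_mem_closure hA
        ⟨closure_minimal (hBs.trans sdiff_subset) hD.1.isClosed hz, hzA⟩ hz)
  obtain ⟨s, hs, hsB⟩ : ∃ s ∈ Icc p q, α s ∈ closure B := by
    by_contra! hcon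
    have hclo : IsClopen B := ⟨isClosed_of_closure_subset fun z hz =>
      (hcl z hz).resolve_right (by rintro ⟨s, hs, rfl⟩; exact hcon s hs hz), hBo⟩
    rcases isClopen_iff.1 hclo with h | h
    · exact Set.notMem_empty x (h ▸ hxB)
    · exact (hBs (h ▸ mem_univ (α p))).2 (mem_image_of_mem _ ⟨le_rfl, hpq.le⟩)
  have hsn : ∀ t ∈ Icc p q, α t ∉ B := fun t ht h => (hBs h).2 (mem_image_of_mem _ ht)
  have hcl' : IsClosed (insert (α s) B) := by
    refine isClosed_of_closure_subset ?_
    rw [insert_eq, closure_union, closure_singleton]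
    rintro z (hz | hz)
    · exact Or.inl hz
    · rcases hcl z hz with h | ⟨t, ht, rfl⟩
      · exact Or.inr h
      · exact Or.inl (by rw [hss ⟨ht, hz⟩ ⟨hs, hsB⟩]; rfl)
  obtain ⟨t, ht, hts⟩ : ∃ t ∈ Icc p q, t ≠ s := by
    by_cases h : s = p
    · exact ⟨q, ⟨hpq.le, le_rfl⟩, by rw [h]; exact hpq.ne'⟩
    · exact ⟨p, ⟨le_rfl, hpq.le⟩, Ne.symm h⟩
  have hcompl : α t ∉ insert (α s) B := by
    rintro (h | h)
    · exact hts (hα.injOn ⟨hp.trans ht.1, ht.2.trans hq⟩ ⟨hp.trans hs.1, hs.2.trans hq⟩ h)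
    · exact hsn t ht h
  have hxs : x ≠ α s := by
    rintro h
    exact hsn s hs (by rw [← h]; exact hxB)
  obtain ⟨m, hm, hmc⟩ := hnw.exists_period_of_cut (c := α s) hf hBo ⟨x, hxB, hxs⟩ hcl'
    ⟨α t, hcompl⟩
  exact hper s hs m hm hmc

theorem IsDendriteSet.finite_mem_closure_diff_arc [ConnectedSpace Y] [LocallyConnectedSpace Y]
    (hf : IsHomeomorph f) (hnw : NonWandering f) (hD : IsDendriteSet D) (hα : IsArcIn D α)
    (hp : 0 ≤ p) (hpq : p < q) (hq : q ≤ 1) (hint : ∀ t ∈ Icc p q, α t ∈ interior D)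
    (hper : ∀ t ∈ Icc p q, ∀ m, 1 ≤ m → f^[m] (α t) ≠ α t) :
    {s ∈ Icc p q | α s ∈ closure (D \ α '' Icc p q)}.Finite := by
  have := hD.2.2.1
  have hA : IsClosed (α '' Icc p q) := (isCompact_Icc.image hα.continuous).isClosed
  have hK : IsCompact (D \ interior D) := hD.1.diff isOpen_interior
  have hKA : ∀ z ∈ D \ interior D, z ∈ D \ α '' Icc p q := fun z hz => ⟨hz.1, by
    rintro ⟨t, ht, rfl⟩
    exact hz.2 (hint t ht)⟩
  obtain ⟨F, -, hcov⟩ := hK.elim_nhdsWithin_subcover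
    (fun z => connectedComponentIn (D \ α '' Icc p q) z) (fun z hz => nhdsWithin_mono z sdiff_subset
      (connectedComponentIn_diff_mem_nhdsWithin hz.1 hA (hKA z hz).2))
  have hU : D \ α '' Icc p q ⊆ ⋃ z ∈ F, connectedComponentIn (D \ α '' Icc p q) z := by
    intro x hx
    obtain ⟨w, hw, hwi⟩ := not_subset.1
      (hD.component_not_subset_interior hf hnw hα hp hpq hq hper hx)
    obtain ⟨z, hz, hwz⟩ := mem_iUnion₂.1 (hcov ⟨(connectedComponentIn_subset _ _ hw).1, hwi⟩)
    refine mem_iUnion₂.2 ⟨z, hz, ?_⟩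
    rw [connectedComponentIn_eq hwz, ← connectedComponentIn_eq hw]
    exact mem_connectedComponentIn hx
  refine (F.finite_toSet.biUnion fun z _ =>
    (hD.subsingleton_mem_closure_component hα hp hq z).finite).subset ?_
  rintro s ⟨hs, hscl⟩
  have h1 := closure_mono hU hscl
  rw [F.closure_biUnion] at h1
  obtain ⟨z, hz, h2⟩ := mem_iUnion₂.1 h1
  exact mem_iUnion₂.2 ⟨z, hz, hs, h2⟩

theorem IsDendriteSet.exists_free_subarc [ConnectedSpace Y] [LocallyConnectedSpace Y]
    (hf : IsHomeomorph f) (hnw : NonWandering f) (hD : IsDendriteSet D) (hα : IsArcIn D α)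
    (hp : 0 ≤ p) (hpq : p < q) (hq : q ≤ 1) (hint : ∀ t ∈ Icc p q, α t ∈ interior D)
    (hper : ∀ t ∈ Icc p q, ∀ m, 1 ≤ m → f^[m] (α t) ≠ α t) :
    ∃ a b, p ≤ a ∧ a < b ∧ b ≤ q ∧ ∀ a' b', a ≤ a' → b' ≤ b → IsOpen (α '' Ioo a' b') := by
  have hfin := hD.finite_mem_closure_diff_arc hf hnw hα hp hpq hq hint hper
  set S := {s ∈ Icc p q | α s ∈ closure (D \ α '' Icc p q)}
  obtain ⟨s, hs⟩ : (Ioo p q \ S).Nonempty := ((Ioo_infinite hpq).sdiff hfin).nonempty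
  obtain ⟨ε, hε, hball⟩ := Metric.nhds_basis_closedBall.mem_iff.1
    ((isOpen_Ioo.sdiff hfin.isClosed).mem_nhds hs)
  rw [Real.closedBall_eq_Icc] at hball
  have hl := (hball ⟨le_rfl, by linarith⟩).1
  have hr := (hball ⟨by linarith, le_rfl⟩).1
  refine ⟨s - ε, s + ε, hl.1.le, by linarith, hr.2.le, fun a' b' ha hb => ?_⟩
  have hA : ∀ c d, IsClosed (α '' Icc c d) := fun c d =>
    (isCompact_Icc.image hα.continuous).isClosed
  have heq : α '' Ioo a' b' =
      (interior D \ closure (D \ α '' Icc p q)) \ (α '' Icc p a' ∪ α '' Icc b' q) := by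
    apply Subset.antisymm
    · rintro _ ⟨t, ht, rfl⟩
      have ht' : t ∈ Ioo p q \ S := hball ⟨ha.trans ht.1.le, ht.2.le.trans hb⟩
      have htI : t ∈ Icc p q := Ioo_subset_Icc_self ht'.1
      have htI' : t ∈ Icc (0 : ℝ) 1 := ⟨hp.trans htI.1, htI.2.trans hq⟩
      refine ⟨⟨hint t htI, fun h => ht'.2 ⟨htI, h⟩⟩, ?_⟩
      rintro (⟨u, hu, hut⟩ | ⟨u, hu, hut⟩)
      · have := hα.injOn ⟨hp.trans hu.1, by linarith [hu.2, ht.1, htI'.2]⟩ htI' hut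
        linarith [hu.2, ht.1]
      · have := hα.injOn ⟨by linarith [hu.1, ht.2, htI'.1], hu.2.trans hq⟩ htI' hut
        linarith [hu.1, ht.2]
    · rintro z ⟨⟨hzD, hzcl⟩, hz⟩
      have hzA : z ∈ α '' Icc p q := by
        by_contra h
        exact hzcl (subset_closure ⟨interior_subset hzD, h⟩)
      obtain ⟨t, ht, rfl⟩ := hzA
      refine ⟨t, ⟨?_, ?_⟩, rfl⟩
      · by_contra h
        exact hz (Or.inl ⟨t, ⟨ht.1, not_lt.1 h⟩, rfl⟩)
      · by_contra h
        exact hz (Or.inr ⟨t, ⟨not_lt.1 h, ht.2⟩, rfl⟩)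
  rw [heq]
  exact (isOpen_interior.sdiff isClosed_closure).sdiff ((hA _ _).union (hA _ _))

theorem Collapses.exists_subinterval_not_periodic {l : Filter ℕ} [l.NeBot] {n : ℕ → ℕ}
    (hf : IsHomeomorph f) (hcol : Collapses f l n (α '' Icc p q)) (hinj : InjOn α (Icc p q))
    (hpq : p < q) :
    ∃ a b, p ≤ a ∧ a < b ∧ b ≤ q ∧ ∀ t ∈ Icc a b, ∀ m, 1 ≤ m → f^[m] (α t) ≠ α t := by
  by_contra! hcon
  obtain ⟨s, hs, m, hm, hms⟩ := hcon p (p + (q - p) / 3) le_rfl (by linarith) (by linarith)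
  obtain ⟨t, ht, m', hm', hmt⟩ := hcon (q - (q - p) / 3) q (by linarith) (by linarith) le_rfl
  have hs' : s ∈ Icc p q := ⟨hs.1, by linarith [hs.2]⟩
  have ht' : t ∈ Icc p q := ⟨by linarith [ht.1], ht.2⟩
  have := hcol.eq_of_periodic hf (mem_image_of_mem _ hs') (mem_image_of_mem _ ht')
    (T := m * m') (Nat.mul_pos hm hm')
    (by rw [Function.iterate_mul]; exact Function.iterate_fixed hms m')
    (by rw [mul_comm, Function.iterate_mul]; exact Function.iterate_fixed hmt m)
  have := hinj hs' ht' this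
  linarith [hs.2, ht.1]

end FreeArc

section FreeArc

variable {Y : Type*} [MetricSpace Y] {f h : Y → Y} {α : ℝ → Y} {a b s t : ℝ}

theorem exists_continuousOn_lift (hα : Continuous α) (hinj : InjOn α (Icc a b)) {φ : ℝ → Y}
    {S : Set ℝ} (hφ : ContinuousOn φ S) (hm : MapsTo φ S (α '' Icc a b)) :
    ∃ g : ℝ → ℝ, ContinuousOn g S ∧ MapsTo g S (Icc a b) ∧ ∀ x ∈ S, α (g x) = φ x := by
  have hm' : ∀ x ∈ S, ∃ y ∈ Icc a b, α y = φ x := hm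
  choose! g hg hgα using hm'
  refine ⟨g, ?_, hg, hgα⟩
  have he : IsClosedEmbedding ((Icc a b).domRestrict α) :=
    (hα.comp continuous_subtype_val).isClosedEmbedding (injOn_iff_injective.1 hinj)
  rw [continuousOn_iff_continuous_domRestrict] at hφ ⊢
  have hc : Continuous fun x : S => (⟨g x, hg x x.2⟩ : Icc a b) := by
    rw [he.isInducing.continuous_iff]
    exact hφ.congr fun x => (hgα x x.2).symm
  exact continuous_subtype_val.comp hc

theorem exists_fixed_on_arc (hα : Continuous α) (hinj : InjOn α (Icc a b)) {k : Y → Y}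
    (hk : Continuous k) {u v : ℝ} (huv : u ≤ v) (hau : a ≤ u) (hvb : v ≤ b)
    (hm : MapsTo (k ∘ α) (Icc u v) (α '' Icc u b)) (hv : k (α v) ∈ α '' Icc a v) :
    ∃ z ∈ Icc u v, k (α z) = α z := by
  obtain ⟨g, hg, hgm, hgα⟩ := exists_continuousOn_lift hα
    (hinj.mono (Icc_subset_Icc_left hau)) (hk.comp hα).continuousOn hm
  obtain ⟨y, hy, hyv⟩ := hv
  have hgv : g v ≤ v := by
    have h1 := hgm (right_mem_Icc.2 huv)
    have : g v = y := hinj ⟨hau.trans h1.1, h1.2⟩ ⟨hy.1, hy.2.trans hvb⟩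
      ((hgα v (right_mem_Icc.2 huv)).trans hyv.symm)
    exact this ▸ hy.2
  have hgu : u ≤ g u := (hgm (left_mem_Icc.2 huv)).1
  obtain ⟨z, hz, hz0⟩ := intermediate_value_Icc' huv (hg.sub continuousOn_id)
    (show (0 : ℝ) ∈ Icc (g v - v) (g u - u) from ⟨by linarith, by linarith⟩)
  have hgz : g z = z := sub_eq_zero.1 hz0
  exact ⟨z, hz, by rw [← Function.comp_apply (f := k), ← hgα z hz, hgz]⟩

theorem IsPreconnected.subset_open_arc {S : Set Y} (hS : IsPreconnected S) (hα : Continuous α)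
    (hst : s < t) (hopen : IsOpen (α '' Ioo s t)) (hne : (S ∩ α '' Ioo s t).Nonempty)
    (hs : α s ∉ S) (ht : α t ∉ S) : S ⊆ α '' Ioo s t := by
  have hcl : IsClosed (α '' Icc s t) := (isCompact_Icc.image hα).isClosed
  refine hS.subset_left_of_subset_union hopen hcl.isOpen_compl
    (disjoint_compl_right.mono_left (image_mono Ioo_subset_Icc_self)) (fun x hx => ?_) hne
  by_cases hxc : x ∈ α '' Icc s t
  · obtain ⟨u, hu, rfl⟩ := hxc
    refine Or.inl ⟨u, ⟨lt_of_le_of_ne hu.1 ?_, lt_of_le_of_ne hu.2 ?_⟩, rfl⟩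
    · rintro rfl; exact hs hx
    · rintro rfl; exact ht hx
  · exact Or.inr hxc

theorem image_Icc_subset_of_image_Ioo_subset (hα : Continuous α) {k : Y → Y} (hk : Continuous k)
    {u v : ℝ} (huv : u < v) (hm : k '' (α '' Ioo u v) ⊆ α '' Ioo s t) :
    MapsTo (k ∘ α) (Icc u v) (α '' Icc s t) := by
  have hcl : IsClosed (α '' Icc s t) := (isCompact_Icc.image hα).isClosed
  have h1 : MapsTo (k ∘ α) (Ioo u v) (α '' Icc s t) := fun x hx =>
    image_mono Ioo_subset_Icc_self (hm (mem_image_of_mem _ (mem_image_of_mem _ hx)))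
  have h2 := h1.closure (hk.comp hα)
  rwa [closure_Ioo huv.ne, hcl.closure_eq] at h2

theorem arc_germ (hh : IsHomeomorph h) (hα : Continuous α) (hinj : InjOn α (Icc a b))
    (hopen : ∀ u v, a ≤ u → v ≤ b → IsOpen (α '' Ioo u v)) (has : a < s) (hst : s < t)
    (htb : t < b) (hstα : h (α s) = α t) :
    α t ∈ interior (α '' Icc s t ∪ h '' (α '' Icc s t)) ∨
      ∃ v, s < v ∧ v ≤ t ∧ h '' (α '' Ioo s v) ⊆ α '' Ioo s t := by
  have hW : (h ∘ α) ⁻¹' (α '' Ioo s b) ∈ 𝓝 s :=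
    ((hopen s b has.le le_rfl).preimage (hh.continuous.comp hα)).mem_nhds
      ⟨t, ⟨hst, htb⟩, hstα.symm⟩
  obtain ⟨δ, hδ, hδs⟩ := Metric.nhds_basis_closedBall.mem_iff.1 hW
  rw [Real.closedBall_eq_Icc] at hδs
  set v := min (s + δ) t
  set w := max (s - δ) a
  have hsv : s < v := lt_min (by linarith) hst
  have hws : w < s := max_lt (by linarith) has
  have hmem : ∀ x ∈ Icc w v, x ∈ Icc a b := fun x hx =>
    ⟨(le_max_right _ _).trans hx.1, hx.2.trans ((min_le_right _ _).trans htb.le)⟩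
  have hm : MapsTo (h ∘ α) (Icc w v) (α '' Ioo s b) := fun x hx =>
    hδs ⟨(le_max_left _ _).trans hx.1, hx.2.trans (min_le_left _ _)⟩
  obtain ⟨g, hg, hgm, hgα⟩ := exists_continuousOn_lift hα hinj (hh.continuous.comp hα).continuousOn
    (hm.mono_right (image_mono fun x (hx : x ∈ Ioo s b) => ⟨has.le.trans hx.1.le, hx.2.le⟩))
  have hgs : ∀ x ∈ Icc w v, s < g x := fun x hx => by
    obtain ⟨y, hy, hyx⟩ := hm hx
    rw [hinj (hgm hx) ⟨has.le.trans hy.1.le, hy.2.le⟩ ((hgα x hx).trans hyx.symm)]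
    exact hy.1
  have hginj : InjOn g (Icc w v) := fun x hx y hy hxy => by
    refine hinj (hmem x hx) (hmem y hy) (hh.injective ?_)
    have := congrArg α hxy
    rwa [hgα x hx, hgα y hy] at this
  have hsI : s ∈ Icc w v := ⟨hws.le, hsv.le⟩
  have hgst : g s = t := hinj (hgm hsI) ⟨(has.trans hst).le, htb.le⟩ ((hgα s hsI).trans hstα)
  have hvI : v ∈ Icc w v := ⟨(hws.trans hsv).le, le_rfl⟩
  rcases hg.strictMonoOn_of_injOn_Icc' (hws.trans hsv).le hginj with hmono | hanti
  · left
    have htv : t < g v := hgst ▸ hmono hsI hvI hsv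
    refine mem_interior.2 ⟨α '' Ioo s (g v), ?_, hopen _ _ has.le (hgm hvI).2, ⟨t, ⟨hst, htv⟩, rfl⟩⟩
    rintro _ ⟨x, hx, rfl⟩
    by_cases hxt : x ≤ t
    · exact Or.inl ⟨x, ⟨hx.1.le, hxt⟩, rfl⟩
    · obtain ⟨y, hy, rfl⟩ := intermediate_value_Icc hsv.le
        (hg.mono (Icc_subset_Icc_left hws.le)) ⟨hgst.trans_le (not_le.1 hxt).le, hx.2.le⟩
      exact Or.inr ⟨α y, ⟨y, ⟨hy.1, hy.2.trans (min_le_right _ _)⟩, rfl⟩,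
        (hgα y ⟨hws.le.trans hy.1, hy.2⟩).symm⟩
  · right
    refine ⟨v, hsv, min_le_right _ _, ?_⟩
    rintro _ ⟨_, ⟨x, hx, rfl⟩, rfl⟩
    have hxI : x ∈ Icc w v := ⟨hws.le.trans hx.1.le, hx.2.le⟩
    exact ⟨g x, ⟨hgs x hxI, hgst ▸ hanti hsI hxI hx.1⟩, hgα x hxI⟩

theorem NonWandering.false_of_arc_return [CompactSpace Y] [ConnectedSpace Y]
    [LocallyConnectedSpace Y] {l : Filter ℕ} [l.NeBot] {n : ℕ → ℕ} (hf : IsHomeomorph f)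
    (hnw : NonWandering h) (hh : IsHomeomorph h) (hα : Continuous α) (hinj : InjOn α (Icc a b))
    (hopen : ∀ u v, a ≤ u → v ≤ b → IsOpen (α '' Ioo u v)) (has : a < s) (hst : s < t)
    (htb : t < b) (hper : ∀ x ∈ Icc a b, ∀ m, 1 ≤ m → h^[m] (α x) ≠ α x)
    (hstα : h (α s) = α t) (hcol : ∀ j, Collapses f l n (h^[j] '' (α '' Icc s t))) : False := by
  have hsI : s ∈ Icc a b := ⟨has.le, (hst.trans htb).le⟩
  have htI : t ∈ Icc a b := ⟨(has.trans hst).le, htb.le⟩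
  have hinj' : InjOn α (Icc s t) := hinj.mono (Icc_subset_Icc has.le htb.le)
  set K := α '' Icc s t with hK
  set U := α '' Ioo s t with hU
  have hUo : IsOpen U := hopen _ _ has.le htb.le
  have hUK : U ⊆ K := image_mono Ioo_subset_Icc_self
  have hUne : U.Nonempty := (nonempty_Ioo.2 hst).image α
  have hUc : IsPreconnected U := isPreconnected_Ioo.image α hα.continuousOn
  have hsU : α s ∉ U := by
    rintro ⟨x, hx, hxs⟩
    exact hx.1.ne' (hinj' (Ioo_subset_Icc_self hx) (left_mem_Icc.2 hst.le) hxs)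
  have hscl : α s ∈ closure U := by
    have : MapsTo α (Ioo s t) U := mapsTo_image _ _
    have := this.closure hα
    rw [closure_Ioo hst.ne] at this
    exact this (left_mem_Icc.2 hst.le)
  have hIo : ∀ j {W : Set Y}, IsOpen W → IsOpen (h^[j] '' W) := fun j W hW =>
    (hh.iterate j).isOpenMap W hW
  have hret : ∃ j, 1 ≤ j ∧ (h^[j] '' U ∩ U).Nonempty := by
    obtain ⟨j, hj, x, hx, hjx⟩ := hnw U hUo hUne
    exact ⟨j, hj, _, mem_image_of_mem _ hx, hjx⟩
  classical
  obtain ⟨i, ⟨hi, hiU⟩, hmin⟩ : ∃ i, (1 ≤ i ∧ (h^[i] '' U ∩ U).Nonempty) ∧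
      ∀ j, 1 ≤ j → (h^[j] '' U ∩ U).Nonempty → i ≤ j :=
    ⟨Nat.find hret, Nat.find_spec hret, fun j hj hjU => Nat.find_min' hret ⟨hj, hjU⟩⟩
  have hnofix : ∀ j, 1 ≤ j → ∀ v, s < v → v ≤ t → h^[j] (α v) ∈ α '' Icc s v →
      ¬ h^[j] '' (α '' Ioo s v) ⊆ U := by
    intro j hj v hsv hvt hv hsub
    have h1 := image_Icc_subset_of_image_Ioo_subset hα (hh.iterate j).continuous hsv hsub
    obtain ⟨z, hz, hfix⟩ := exists_fixed_on_arc hα hinj (hh.iterate j).continuous hsv.le has.le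
      (hvt.trans htb.le) (h1.mono_right (image_mono (Icc_subset_Icc_right htb.le)))
      (image_mono (Icc_subset_Icc_left has.le) hv)
    exact hper z ⟨has.le.trans hz.1, hz.2.trans (hvt.trans htb.le)⟩ j hj hfix
  have hsi : α s ∈ h^[i] '' U := by
    by_contra hsi
    by_cases hti : α t ∈ h^[i] '' U
    · obtain ⟨y, hy, hyt⟩ := hti
      obtain ⟨j, rfl⟩ := Nat.exists_eq_add_of_le' hi
      rw [Function.iterate_succ_apply', ← hstα] at hyt
      have hyj : h^[j] y = α s := hh.injective hyt
      rcases Nat.eq_zero_or_pos j with rfl | hj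
      · exact hsU (hyj ▸ hy)
      · have := mem_closure_iff.1 hscl _ (hIo j hUo) ⟨y, hy, hyj⟩
        exact absurd (hmin j hj this) (by omega)
    · have hsub := (hUc.image _ (hh.iterate i).continuous.continuousOn).subset_open_arc hα hst hUo
        hiU hsi hti
      have h1 := image_Icc_subset_of_image_Ioo_subset hα (hh.iterate i).continuous hst hsub
      exact hnofix i hi t hst le_rfl (h1 (right_mem_Icc.2 hst.le)) hsub
  have hgerm : α t ∈ interior (K ∪ h '' K) := by
    rcases arc_germ hh hα hinj hopen has hst htb hstα with h1 | ⟨v, hsv, hvt, hv⟩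
    · exact h1
    exfalso
    obtain ⟨x, hx⟩ := nonempty_Ioo.2 hsv
    have hi1 : i = 1 := le_antisymm (hmin 1 le_rfl ⟨h (α x),
      ⟨α x, ⟨x, ⟨hx.1, hx.2.trans_le hvt⟩, rfl⟩, rfl⟩,
      hv (mem_image_of_mem _ (mem_image_of_mem _ hx))⟩) hi
    subst hi1
    obtain ⟨_, ⟨u, hu, rfl⟩, hus⟩ := hsi
    rw [Function.iterate_one] at hus
    refine hnofix 1 le_rfl u hu.1 hu.2.le ?_ ?_
    · rw [Function.iterate_one, hus]
      exact mem_image_of_mem _ (left_mem_Icc.2 hu.1.le)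
    · rw [Function.iterate_one]
      have hin : ∀ y ∈ Ioo s u, y ∈ Icc s t := fun y hy => ⟨hy.1.le, (hy.2.trans hu.2).le⟩
      refine ((isPreconnected_Ioo.image α hα.continuousOn).image h
        hh.continuous.continuousOn).subset_open_arc hα hst hUo ?_ ?_ ?_
      · obtain ⟨y, hy⟩ := nonempty_Ioo.2 (lt_min hsv hu.1)
        exact ⟨h (α y), mem_image_of_mem _ (mem_image_of_mem _ ⟨hy.1, hy.2.trans_le (min_le_right _ _)⟩),
          hv (mem_image_of_mem _ (mem_image_of_mem _ ⟨hy.1, hy.2.trans_le (min_le_left _ _)⟩))⟩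
      · rintro ⟨_, ⟨y, hy, rfl⟩, hys⟩
        exact hy.2.ne (hinj' (hin y hy) (Ioo_subset_Icc_self hu) (hh.injective (hys.trans hus.symm)))
      · rintro ⟨_, ⟨y, hy, rfl⟩, hyt⟩
        exact hy.1.ne' (hinj' (hin y hy) (left_mem_Icc.2 hst.le)
          (hh.injective (hyt.trans hstα.symm)))
  set Z := accumulate (fun j => h^[j] '' K) i with hZ
  have hsubZ : ∀ j ≤ i, h^[j] '' K ⊆ Z := fun j hj x hx => mem_accumulate.2 ⟨j, hj, hx⟩
  have hZcl : IsClosed Z := (finite_le_nat i).isClosed_biUnion fun j _ =>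
    ((isCompact_Icc.image hα).image (hh.iterate j).continuous).isClosed
  have hZcol : ∀ k, Collapses f l n (accumulate (fun j => h^[j] '' K) k) := by
    intro k
    induction k with
    | zero => simpa using hcol 0
    | succ k ih =>
      rw [accumulate_succ]
      refine ih.union hf (hcol _) ⟨h^[k] (α t), mem_accumulate.2 ⟨k, le_rfl,
        mem_image_of_mem _ (mem_image_of_mem _ (right_mem_Icc.2 hst.le))⟩, α s,
        mem_image_of_mem _ (left_mem_Icc.2 hst.le), ?_⟩
      rw [Function.iterate_succ_apply, hstα]
  set p := h^[i + 1] (α s) with hp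
  have hintU : ∀ j ≤ i, h^[j] '' U ⊆ interior Z := fun j hj =>
    interior_maximal ((image_mono hUK).trans (hsubZ j hj)) (hIo j hUo)
  have hintt : ∀ j ≤ i, h^[j] (α t) = p ∨ h^[j] (α t) ∈ interior Z := by
    intro j hj
    rcases hj.eq_or_lt with rfl | hj
    · left
      rw [hp, Function.iterate_succ_apply, hstα]
    · right
      have : h^[j] '' interior (K ∪ h '' K) ⊆ interior Z := by
        refine interior_maximal ((image_mono interior_subset).trans ?_) (hIo j isOpen_interior)
        have h1 := hsubZ (j + 1) hj
        rw [Function.iterate_succ, image_comp] at h1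
        rw [image_union]
        exact union_subset (hsubZ j hj.le) h1
      exact this (mem_image_of_mem _ hgerm)
  have hint : ∀ z ∈ Z, z = p ∨ z ∈ interior Z := by
    intro z hz
    obtain ⟨j, hj, _, ⟨x, hx, rfl⟩, rfl⟩ := mem_accumulate.1 hz
    rcases hx.1.eq_or_lt with rfl | hsx
    · rcases Nat.eq_zero_or_pos j with rfl | hj0
      · exact Or.inr (hintU i le_rfl hsi)
      · obtain ⟨j, rfl⟩ := Nat.exists_eq_add_of_le' hj0
        rw [Function.iterate_succ_apply, hstα]
        exact hintt j (by omega)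
    rcases hx.2.eq_or_lt with rfl | hxt
    · exact hintt j hj
    · exact Or.inr (hintU j hj (mem_image_of_mem _ (mem_image_of_mem _ ⟨hsx, hxt⟩)))
  have hpZ : p ∈ Z := by
    refine hsubZ i le_rfl ⟨α t, mem_image_of_mem _ (right_mem_Icc.2 hst.le), ?_⟩
    rw [hp, Function.iterate_succ_apply, hstα]
  have : Nontrivial Y := ⟨α s, α t, fun he =>
    hst.ne (hinj hsI htI he)⟩
  have hZne : Z ≠ univ := (hZcol i).ne_univ
  have hins : insert p (interior Z \ {p}) = Z := by
    ext z
    constructor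
    · rintro (rfl | hz)
      · exact hpZ
      · exact interior_subset hz.1
    · intro hz
      by_cases hzp : z = p
      · exact Or.inl hzp
      · exact Or.inr ⟨(hint z hz).resolve_left hzp, hzp⟩
  have hne : ((interior Z \ {p}) \ {p}).Nonempty := by
    by_contra hcon
    have hUp : ∀ x ∈ U, x = p := fun x hx => by
      by_contra hxp
      refine hcon ⟨x, ⟨hintU 0 (Nat.zero_le _) (by simpa using hx), hxp⟩, hxp⟩
    obtain ⟨x, hx⟩ := nonempty_Ioo.2 hst
    obtain ⟨y, hy⟩ := nonempty_Ioo.2 hx.1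
    refine hy.2.ne (hinj' ⟨hy.1.le, (hy.2.trans hx.2).le⟩ (Ioo_subset_Icc_self hx) ?_)
    rw [hUp _ (mem_image_of_mem _ hx), hUp _ (mem_image_of_mem _ ⟨hy.1, hy.2.trans hx.2⟩)]
  obtain ⟨m, hm, hmp⟩ := hnw.exists_period_of_cut hh
    (isOpen_interior.sdiff isClosed_singleton) hne (by rw [hins]; exact hZcl)
    (by rw [hins]; exact nonempty_compl.2 hZne)
  refine hper s hsI m hm ((hh.iterate (i + 1)).injective ?_)
  rw [← Function.iterate_add_apply, add_comm, Function.iterate_add_apply]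
  exact hmp

theorem NonWandering.false_of_free_arc [CompactSpace Y] [ConnectedSpace Y]
    [LocallyConnectedSpace Y] {l : Filter ℕ} [l.NeBot] {n : ℕ → ℕ} (hf : IsHomeomorph f)
    (hnw : NonWandering f) (hα : Continuous α) (hab : a < b) (hinj : InjOn α (Icc a b))
    (hopen : ∀ u v, a ≤ u → v ≤ b → IsOpen (α '' Ioo u v))
    (hper : ∀ x ∈ Icc a b, ∀ m, 1 ≤ m → f^[m] (α x) ≠ α x)
    (hcol : Collapses f l n (α '' Icc a b)) : False := by
  obtain ⟨m, hm, _, ⟨s, hs, rfl⟩, t, ht, hst⟩ := hnw (α '' Ioo a b) (hopen _ _ le_rfl le_rfl)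
    ((nonempty_Ioo.2 hab).image α)
  have hnwm : NonWandering f^[m] := fun W hW hne => by
    obtain ⟨k, hk, x, hx, hkx⟩ := hnw.exists_mul hf.continuous hW hne hm
    exact ⟨k, hk, x, hx, by rwa [← Function.iterate_mul]⟩
  have hperm : ∀ x ∈ Icc a b, ∀ k, 1 ≤ k → (f^[m])^[k] (α x) ≠ α x := fun x hx k hk => by
    rw [← Function.iterate_mul]
    exact hper x hx _ (Nat.mul_pos hm hk)
  have hcolm : ∀ S ⊆ α '' Icc a b, ∀ j, Collapses f l n ((f^[m])^[j] '' S) := fun S hS j => by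
    rw [← Function.iterate_mul]
    exact (hcol.mono hS).image_iterate hf _
  rcases lt_trichotomy s t with h1 | rfl | h1
  · exact hnwm.false_of_arc_return hf (hf.iterate m) hα hinj hopen hs.1 h1 ht.2 hperm hst.symm
      (hcolm _ (image_mono (Icc_subset_Icc hs.1.le ht.2.le)))
  · exact hper s (Ioo_subset_Icc_self hs) m hm hst.symm
  · have himI : ∀ u v, (fun x => α (-x)) '' Icc u v = α '' Icc (-v) (-u) := fun u v => by
      rw [← image_neg_Icc, image_image]
    have himO : ∀ u v, (fun x => α (-x)) '' Ioo u v = α '' Ioo (-v) (-u) := fun u v => by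
      rw [← image_neg_Ioo, image_image]
    refine hnwm.false_of_arc_return (l := l) (n := n) (α := fun x => α (-x)) (a := -b) (b := -a) (s := -s)
      (t := -t) hf (hf.iterate m) (hα.comp continuous_neg) ?_ ?_ (neg_lt_neg hs.2)
      (neg_lt_neg h1) (neg_lt_neg ht.1) ?_ ?_ ?_
    · intro x hx y hy hxy
      exact neg_injective (hinj ⟨by linarith [hx.2], by linarith [hx.1]⟩
        ⟨by linarith [hy.2], by linarith [hy.1]⟩ hxy)
    · intro u v hu hv
      rw [himO]
      exact hopen _ _ (by linarith) (by linarith)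
    · exact fun x hx => hperm (-x) ⟨by linarith [hx.2], by linarith [hx.1]⟩
    · simpa using hst.symm
    · rw [himI, neg_neg, neg_neg]
      exact hcolm _ (image_mono (Icc_subset_Icc ht.1.le hs.2.le))

end FreeArc

theorem IsLocalDendrite.equicontinuous_of_nonWandering {Y : Type*} [MetricSpace Y] [CompactSpace Y]
    [ConnectedSpace Y] (hY : IsLocalDendrite Y) {f : Y → Y} (hf : IsHomeomorph f)
    (hnw : NonWandering f) {ε : ℝ} (hε : 0 < ε) :
    ∃ δ > 0, ∀ n x y, dist x y < δ → dist (f^[n] x) (f^[n] y) < ε := by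
  by_contra! hne
  have := hY.locallyConnectedSpace
  obtain ⟨n, D, α, p, q, hD, hα, hp, hpq, hq, hint, hcol⟩ := exists_collapsing_arc hY hf hε hne
  obtain ⟨p', q', hp', hpq', hq', hper⟩ := hcol.exists_subinterval_not_periodic hf
    (hα.injOn.mono (Icc_subset_Icc hp.le hq.le)) hpq
  obtain ⟨a, b, ha, hab, hb, hopen⟩ := hD.exists_free_subarc hf hnw hα (hp.le.trans hp') hpq'
    (hq'.trans hq.le) (fun t ht => hint t ⟨hp'.trans ht.1, ht.2.trans hq'⟩) hper
  exact hnw.false_of_free_arc hf hα.continuous hab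
    (hα.injOn.mono (Icc_subset_Icc (hp.le.trans (hp'.trans ha)) (hb.trans (hq'.trans hq.le))))
    hopen (fun t ht => hper t ⟨ha.trans ht.1, ht.2.trans hb⟩)
    (hcol.mono (image_mono (Icc_subset_Icc (hp'.trans ha) (hb.trans hq'))))

theorem polGrowth_eq_zero_of_le {u : ℕ → ℕ∞} {N : ℕ} (hu : ∀ n, u n ≤ N) : polGrowth u = 0 := by
  have hlim : Tendsto (fun n : ℕ => ENNReal.ofReal (Real.log ((N + 1 : ℕ) : ℝ) / Real.log n))
      atTop (𝓝 0) := by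
    have := (Real.tendsto_log_atTop.comp tendsto_natCast_atTop_atTop).const_div_atTop
      (Real.log ((N + 1 : ℕ) : ℝ))
    simpa using ENNReal.tendsto_ofReal this
  refine (tendsto_of_tendsto_of_tendsto_of_le_of_le tendsto_const_nhds hlim
    (fun _ => zero_le) fun n => ?_).limsup_eq
  obtain ⟨k, hk⟩ := ENat.ne_top_iff_exists.1 (ne_top_of_le_ne_top (ENat.natCast_ne_top N) (hu n))
  have hkN : k ≤ N := by exact_mod_cast hk ▸ hu n
  simp only [← hk, ENat.natCast_ne_top, if_false, ENat.toNat_natCast]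
  refine ENNReal.ofReal_le_ofReal (div_le_div_of_nonneg_right ?_ (Real.log_natCast_nonneg n))
  rcases Nat.eq_zero_or_pos k with rfl | hk0
  · simpa using Real.log_natCast_nonneg (N + 1)
  · exact Real.log_le_log (by exact_mod_cast hk0) (by exact_mod_cast hkN.trans N.le_succ)

theorem hpol_eq_zero_of_equicontinuous {Z : Type*} [PseudoMetricSpace Z]
    (htb : TotallyBounded (univ : Set Z)) {g : Z → Z}
    (hg : ∀ ε > 0, ∃ δ > 0, ∀ n x y, dist x y < δ → dist (g^[n] x) (g^[n] y) < ε) :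
    hpol g = 0 := by
  simp only [hpol, ENNReal.iSup_eq_zero]
  intro ε hε
  obtain ⟨δ, hδ, hgδ⟩ := hg ε hε
  obtain ⟨T, hT, hcov⟩ := Metric.totallyBounded_iff.1 htb (δ / 2) (half_pos hδ)
  refine polGrowth_eq_zero_of_le (N := hT.toFinset.card) fun n => iSup₂_le fun E hE => ?_
  have hc : ∀ x : Z, ∃ y ∈ T, dist x y < δ / 2 := fun x => by
    simpa using hcov (mem_univ x)
  choose c hcT hc using hc
  refine Nat.cast_le.2 (Finset.card_le_card_of_injOn c (fun x _ => by simpa using hcT x) ?_)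
  intro x hx y hy hxy
  by_contra hne
  refine absurd (hE x hx y hy hne) (not_le.2 ?_)
  have hd : dist x y < δ := by
    have h1 := hc x
    rw [hxy] at h1
    linarith [hc y, dist_triangle_right x y (c y)]
  have : ((Finset.range n).sup fun k => nndist (g^[k] x) (g^[k] y)) < ⟨ε, hε.le⟩ := by
    rw [Finset.sup_lt_iff (show (⊥ : ℝ≥0) < ⟨ε, hε.le⟩ from hε)]
    exact fun k _ => hgδ k x y hd
  exact this

theorem coe_symmMap_iterate {Y : Type*} [MetricSpace Y] {f : Y → Y} (hf : Continuous f) (n k : ℕ)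
    (A : SymmProd Y n) : (((symmMap f hf n)^[k] A).1 : Set Y) = f^[k] '' (A.1 : Set Y) := by
  induction k with
  | zero => simp
  | succ k ih =>
    rw [Function.iterate_succ_apply', Function.iterate_succ', image_comp, ← ih]
    rfl

theorem totallyBounded_univ_symmProd {Y : Type*} [MetricSpace Y] [CompactSpace Y] (n : ℕ) :
    TotallyBounded (univ : Set (SymmProd Y n)) :=
  totallyBounded_preimage (s := univ) isUniformEmbedding_subtype_val.isUniformInducing
    isCompact_univ.totallyBounded

theorem symmMap_equicontinuous {Y : Type*} [MetricSpace Y] {f : Y → Y} (hf : Continuous f)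
    (n : ℕ) (h : ∀ ε > 0, ∃ δ > 0, ∀ n x y, dist x y < δ → dist (f^[n] x) (f^[n] y) < ε)
    {ε : ℝ} (hε : 0 < ε) :
    ∃ δ > 0, ∀ k A B, dist A B < δ →
      dist ((symmMap f hf n)^[k] A) ((symmMap f hf n)^[k] B) < ε := by
  obtain ⟨δ, hδ, hfδ⟩ := h (ε / 2) (half_pos hε)
  refine ⟨δ, hδ, fun k A B hAB => ?_⟩
  rw [Subtype.dist_eq, Metric.NonemptyCompacts.dist_eq] at hAB ⊢
  have key : ∀ A B : SymmProd Y n, Metric.hausdorffDist (A.1 : Set Y) B.1 < δ →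
      ∀ x ∈ f^[k] '' (A.1 : Set Y), ∃ y ∈ f^[k] '' (B.1 : Set Y), dist x y ≤ ε / 2 := by
    rintro A B hAB _ ⟨x, hx, rfl⟩
    obtain ⟨y, hy, hxy⟩ := Metric.exists_dist_lt_of_hausdorffDist_lt hx hAB
      (Metric.hausdorffEDist_ne_top_of_nonempty_of_bounded A.1.nonempty B.1.nonempty
        A.1.isCompact.isBounded B.1.isCompact.isBounded)
    exact ⟨_, mem_image_of_mem _ hy, (hfδ k x y hxy).le⟩
  refine lt_of_le_of_lt ?_ (half_lt_self hε)
  rw [coe_symmMap_iterate, coe_symmMap_iterate]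
  exact Metric.hausdorffDist_le_of_mem_dist (half_pos hε).le (key A B hAB)
    (key B A (by rwa [Metric.hausdorffDist_comm]))

/-- for a homeomorphism `f` without wandering points on a local dendrite, the
induced map `F_n(f)` on the `n`-fold symmetric product satisfies `h_pol(F_n(f)) = 0`. -/
theorem hpol_symmMap_eq_zero_of_isLocalDendrite_of_no_wandering
    {X : Type*} [MetricSpace X] [CompactSpace X] [ConnectedSpace X] [Nonempty X]
    (hX : IsLocalDendrite X) (f : X → X) (hf : IsHomeomorph f)
    (hw : ∀ p : X, ¬ IsWanderingPoint f p) (n : ℕ) (hn : 1 ≤ n) :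
    hpol (symmMap f hf.continuous n) = 0 := by
  have hnw := nonWandering_of_forall_not_isWanderingPoint hw
  exact hpol_eq_zero_of_equicontinuous (totallyBounded_univ_symmProd n) fun ε hε =>
    symmMap_equicontinuous hf.continuous n
      (fun ε hε => hX.equicontinuous_of_nonWandering hf hnw hε) hε
end
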